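/- arXiv:math/9911007 — 3 statements merged into one kernel-verified Lean document; each statement's English description precedes it below -/
import Mathlib

section
/- Let A be a unital C*-algebra with a faithful state φ, let B ⊆ A be a C*-subalgebra, and let E : A → B be a projection of norm 1 (i.e., a linear map with E(b) = b for all b ∈ B and ‖E(a)‖ ≤ ‖a‖ for all a ∈ A) satisfying φ ∘ E = φ. Then the kernel of E equals A ⊖ B := {a ∈ A : φ(b a) = 0 for all b ∈ B}. -/
/-- One step of the Tomiyama estimate. -/
lemma tom_step {A : Type*} [CStarAlgebra A] (B : StarSubalgebra ℂ A) (E : A →ₗ[ℂ] A)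
    (hE_mem : ∀ a : A, E a ∈ B) (hE_id : ∀ b ∈ B, E b = b) (hE_norm : ∀ a : A, ‖E a‖ ≤ ‖a‖)
    (b c₁ c₂ x : A) (hc₂ : c₂ ∈ B) (hbc : star b * c₂ = 0) (hcb : star c₂ * b = 0)
    (h12 : c₁ * c₂ = c₁) (hc₁ : ‖c₁‖ ≤ 1) (t : ℝ) (ht : 0 ≤ t) :
    (1 + t) ^ 2 * ‖c₁ * E (b * x)‖ ^ 2 ≤ ‖b * x‖ ^ 2 + t ^ 2 * ‖c₂ * E (b * x)‖ ^ 2 := by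
  set y := E (b * x) with hy
  have hyB : y ∈ B := hE_mem _
  set z := b * x + (t : ℂ) • (c₂ * y) with hz
  have hEz : E z = y + (t : ℂ) • (c₂ * y) := by
    rw [hz, map_add, map_smul, hE_id _ (B.mul_mem hc₂ hyB)]
  have h1 : c₁ * E z = ((1 + t : ℝ) : ℂ) • (c₁ * y) := by
    rw [hEz, mul_add, mul_smul_comm, ← mul_assoc, h12]
    push_cast
    rw [add_smul, one_smul]
  have h2 : (1 + t) * ‖c₁ * y‖ ≤ ‖z‖ := by
    have : ‖c₁ * E z‖ = (1 + t) * ‖c₁ * y‖ := by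
      rw [h1, norm_smul, Complex.norm_real, Real.norm_of_nonneg (by positivity)]
    rw [← this]
    calc ‖c₁ * E z‖ ≤ ‖c₁‖ * ‖E z‖ := norm_mul_le _ _
      _ ≤ 1 * ‖z‖ := by gcongr; exact hE_norm z
      _ = ‖z‖ := one_mul _
  have h3 : star z * z = star (b * x) * (b * x) + ((t ^ 2 : ℝ) : ℂ) • (star (c₂ * y) * (c₂ * y)) := by
    have e1 : star (b * x) * (c₂ * y) = 0 := by
      rw [star_mul, mul_assoc, ← mul_assoc (star b), hbc]; simp
    have e2 : star (c₂ * y) * (b * x) = 0 := by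
      rw [star_mul, mul_assoc, ← mul_assoc (star c₂), hcb]; simp
    rw [hz, star_add, star_smul, add_mul, mul_add, mul_add, mul_smul_comm, e1, smul_mul_assoc, e2,
      smul_mul_assoc, mul_smul_comm, smul_smul]
    simp [pow_two]
  have h4 : ‖z‖ ^ 2 ≤ ‖b * x‖ ^ 2 + t ^ 2 * ‖c₂ * y‖ ^ 2 := by
    rw [pow_two ‖z‖, ← CStarRing.norm_star_mul_self, h3]
    refine (norm_add_le _ _).trans ?_
    rw [norm_smul, Complex.norm_real, Real.norm_of_nonneg (by positivity),
      CStarRing.norm_star_mul_self, CStarRing.norm_star_mul_self, pow_two ‖b * x‖,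
      pow_two ‖c₂ * y‖]
  calc (1 + t) ^ 2 * ‖c₁ * y‖ ^ 2 = ((1 + t) * ‖c₁ * y‖) ^ 2 := by ring
    _ ≤ ‖z‖ ^ 2 := by gcongr
    _ ≤ _ := h4

/-- The cut-off function. -/
def clampR (r : ℝ) : ℝ := max 0 (min 1 r)

lemma clampR_cont : Continuous clampR := by unfold clampR; fun_prop
lemma clampR_nonneg (r : ℝ) : 0 ≤ clampR r := by simp [clampR]
lemma clampR_le_one (r : ℝ) : clampR r ≤ 1 := by simp [clampR]
lemma clampR_of_le {r : ℝ} (h : r ≤ 0) : clampR r = 0 := by simp [clampR, h]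
lemma clampR_of_ge {r : ℝ} (h : 1 ≤ r) : clampR r = 1 := by simp [clampR, h]

/-- Real sequence lemma. -/
lemma seq_zero (s : ℕ → ℝ) (M K : ℝ) (hs : ∀ n, 0 ≤ s n) (hK : ∀ n, s n ≤ K)
    (h : ∀ n, ∀ t : ℝ, 0 ≤ t → (1 + t) ^ 2 * s n ≤ M + t ^ 2 * s (n + 1)) (n : ℕ) : s n = 0 := by
  have hb : BddAbove (Set.range s) := ⟨K, by rintro _ ⟨n, rfl⟩; exact hK n⟩
  set S := ⨆ n, s n with hS
  have hle : ∀ n, s n ≤ S := fun n => le_ciSup hb n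
  have key : ∀ t : ℝ, 0 ≤ t → (1 + 2 * t) * S ≤ M := by
    intro t ht
    have h1 : S ≤ (M + t ^ 2 * S) / (1 + t) ^ 2 := by
      apply ciSup_le
      intro n
      rw [le_div_iff₀ (by positivity), mul_comm]
      refine (h n t ht).trans ?_
      gcongr
      exact hle _
    rw [le_div_iff₀ (by positivity)] at h1
    nlinarith
  have hS0 : S ≤ 0 := by
    by_contra hpos
    push Not at hpos
    have hM : 0 ≤ M := by have := key 0 le_rfl; nlinarith
    have h2 := key (M / S) (by positivity)
    have : M / S * S = M := by field_simp
    nlinarith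
  exact le_antisymm ((hle n).trans hS0) (hs n)

/-- Locality. -/
lemma tom_local {A : Type*} [CStarAlgebra A] (B : StarSubalgebra ℂ A)
    (hBclosed : IsClosed (B : Set A)) (E : A →ₗ[ℂ] A)
    (hE_mem : ∀ a : A, E a ∈ B) (hE_id : ∀ b ∈ B, E b = b) (hE_norm : ∀ a : A, ‖E a‖ ≤ ‖a‖)
    (h : A) (hh : IsSelfAdjoint h) (hB : h ∈ B) (f g : ℝ → ℝ) (hf : Continuous f)
    (hg : Continuous g) (hfg : ∀ s, g s * f s = 0) (x : A) :
    cfc g h * E (cfc f h * x) = 0 := by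
  set y := E (cfc f h * x) with hy
  let θ : ℕ → ℝ → ℝ := fun n s => clampR (2 ^ n * |g s| - 1)
  have hθc : ∀ n, Continuous (θ n) := fun n => clampR_cont.comp (by fun_prop)
  have hsa : ∀ f : ℝ → ℝ, star (cfc f h) = cfc f h := fun f => (cfc_predicate f h : IsSelfAdjoint _)
  have hz : ∀ n s, θ n s * f s = 0 := by
    intro n s
    rcases mul_eq_zero.1 (hfg s) with h0 | h0
    · simp [θ, h0, clampR]
    · simp [h0]
  have hzero : ∀ k : ℝ → ℝ, (∀ s, k s = 0) → cfc k h = 0 := by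
    intro k hk
    rw [show k = 0 from funext hk]; exact cfc_zero ℝ h
  have hθθ : ∀ n s, θ n s * θ (n + 1) s = θ n s := by
    intro n s
    rcases le_total (2 ^ n * |g s| - 1) 0 with h0 | h0
    · simp [θ, clampR_of_le h0]
    · have : θ (n + 1) s = 1 := clampR_of_ge (by rw [pow_succ]; linarith)
      rw [this, mul_one]
  have hθn : ∀ n, ‖cfc (θ n) h‖ ≤ 1 := fun n => norm_cfc_le zero_le_one fun s _ => by
    rw [Real.norm_of_nonneg (clampR_nonneg _)]; exact clampR_le_one _
  have hs : ∀ n, ‖cfc (θ n) h * y‖ ^ 2 = 0 := by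
    apply seq_zero (fun n => ‖cfc (θ n) h * y‖ ^ 2) (‖cfc f h * x‖ ^ 2) (‖y‖ ^ 2)
    · intro n; positivity
    · intro n
      have : ‖cfc (θ n) h * y‖ ≤ ‖y‖ := (norm_mul_le _ _).trans (by
        have := mul_le_mul_of_nonneg_right (hθn n) (norm_nonneg y); linarith)
      gcongr
    · intro n t ht
      refine tom_step B E hE_mem hE_id hE_norm (cfc f h) (cfc (θ n) h) (cfc (θ (n+1)) h) x
        (cfc_mem (𝕜' := ℂ) (hs := hBclosed) _ hB) ?_ ?_ ?_ (hθn n) t ht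
      · rw [hsa, ← cfc_mul _ _ h hf.continuousOn (hθc _).continuousOn]
        exact hzero _ fun s => by rw [mul_comm]; exact hz _ s
      · rw [hsa, ← cfc_mul _ _ h (hθc _).continuousOn hf.continuousOn]
        exact hzero _ fun s => hz _ s
      · rw [← cfc_mul _ _ h (hθc _).continuousOn (hθc _).continuousOn]
        congr 1
        exact funext (hθθ n)
  have hs' : ∀ n, cfc (θ n) h * y = 0 := fun n => by simpa using hs n
  have hbound : ∀ n : ℕ, ‖cfc g h * y‖ ≤ 2 * ‖y‖ * (1 / 2) ^ n := by
    intro n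
    have e : cfc g h * y = cfc (fun s => g s - g s * θ n s) h * y := by
      rw [cfc_sub (fun s => g s) (fun s => g s * θ n s) h hg.continuousOn
          (hg.mul (hθc n)).continuousOn,
        cfc_mul _ _ h hg.continuousOn (hθc n).continuousOn, sub_mul, mul_assoc _ _ y, hs' n]
      simp
    rw [e]
    have : ‖cfc (fun s => g s - g s * θ n s) h‖ ≤ 2 * (1 / 2) ^ n := by
      apply norm_cfc_le (by positivity)
      intro s _
      have e2 : g s - g s * θ n s = g s * (1 - θ n s) := by ring
      rw [e2, norm_mul, Real.norm_eq_abs, Real.norm_of_nonneg (by linarith [clampR_le_one (2 ^ n * |g s| - 1)])]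
      have hp : (0 : ℝ) < 2 ^ n := by positivity
      rcases le_total 1 (2 ^ n * |g s| - 1) with h1 | h1
      · have : θ n s = 1 := clampR_of_ge h1
        rw [this]; simp
      · have h3 : |g s| ≤ 2 * (1 / 2) ^ n := by
          rw [one_div, inv_pow, ← div_eq_mul_inv, le_div_iff₀ hp]; linarith
        have h4 : 0 ≤ θ n s := clampR_nonneg _
        nlinarith [abs_nonneg (g s)]
    calc _ ≤ _ := norm_mul_le _ _
      _ ≤ 2 * (1 / 2) ^ n * ‖y‖ := by gcongr
      _ = _ := by ring
  have hlim : Filter.Tendsto (fun n : ℕ => 2 * ‖y‖ * (1 / 2 : ℝ) ^ n) Filter.atTop (nhds 0) := by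
    simpa using (tendsto_pow_atTop_nhds_zero_of_lt_one (r := (1/2 : ℝ)) (by norm_num)
      (by norm_num)).const_mul (2 * ‖y‖)
  have := ge_of_tendsto' hlim hbound
  exact norm_le_zero_iff.1 this

/-- Commutation with a locally constant function. -/
lemma tom_comm {A : Type*} [CStarAlgebra A] (B : StarSubalgebra ℂ A)
    (hBclosed : IsClosed (B : Set A)) (E : A →ₗ[ℂ] A)
    (hE_mem : ∀ a : A, E a ∈ B) (hE_id : ∀ b ∈ B, E b = b) (hE_norm : ∀ a : A, ‖E a‖ ≤ ‖a‖)
    (h : A) (hh : IsSelfAdjoint h) (hB : h ∈ B) (f c : ℝ → ℝ) (hf : Continuous f)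
    (hc : Continuous c) (hfc : ∀ s, c s * (1 - c s) * f s = 0) (x : A) :
    cfc c h * E (cfc f h * x) = E (cfc c h * (cfc f h * x)) := by
  have hc1 : Continuous fun s => 1 - c s := by fun_prop
  have e1 := tom_local B hBclosed E hE_mem hE_id hE_norm h hh hB (fun s => (1 - c s) * f s) c
    (hc1.mul hf) hc (fun s => by rw [← mul_assoc]; exact hfc s) x
  have e2 := tom_local B hBclosed E hE_mem hE_id hE_norm h hh hB (fun s => c s * f s)
    (fun s => 1 - c s) (hc.mul hf) hc1 (fun s => by rw [← hfc s]; ring) x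
  have e3 : cfc (fun s => 1 - c s) h = 1 - cfc c h := by
    rw [cfc_sub _ _ h continuousOn_const hc.continuousOn, cfc_const_one ℝ h]
  rw [cfc_mul _ _ h hc1.continuousOn hf.continuousOn, e3, sub_mul, sub_mul, one_mul, map_sub,
    mul_sub, sub_eq_zero, mul_assoc] at e1
  rw [cfc_mul _ _ h hc.continuousOn hf.continuousOn, e3, sub_mul, one_mul, sub_eq_zero,
    mul_assoc] at e2
  rw [e1, ← e2]

/-- The staircase function. -/
noncomputable def stair (α : ℝ) (n : ℕ) (s : ℝ) : ℝ :=
  ∑ i ∈ Finset.range n, 2 * Real.pi * clampR (s - α - 2 * Real.pi * i)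

lemma stair_top (α : ℝ) (hα : α ≤ Real.pi) (n : ℕ) (s : ℝ) (hs : 2 * Real.pi * n ≤ s) :
    stair α n s = 2 * Real.pi * n := by
  have hpi := Real.pi_gt_three
  have : ∀ i ∈ Finset.range n, 2 * Real.pi * clampR (s - α - 2 * Real.pi * i) = 2 * Real.pi := by
    intro i hi
    have hi' : (i : ℝ) + 1 ≤ n := by exact_mod_cast Finset.mem_range.1 hi
    rw [clampR_of_ge, mul_one]
    nlinarith
  rw [stair, Finset.sum_congr rfl this]
  simp; ring

lemma stair_bound (α : ℝ) (h0 : 0 ≤ α) (hα : α ≤ Real.pi) (n : ℕ) (s : ℝ) (hs0 : 0 ≤ s)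
    (hs : s ≤ 2 * Real.pi * n) : |s - stair α n s| ≤ 2 * Real.pi := by
  have hpi := Real.pi_gt_three
  induction n with
  | zero =>
    have : s = 0 := le_antisymm (by simpa using hs) hs0
    simp [this, stair]; positivity
  | succ n ih =>
    have e : stair α (n + 1) s = stair α n s + 2 * Real.pi * clampR (s - α - 2 * Real.pi * n) :=
      Finset.sum_range_succ _ _
    rcases le_total s (2 * Real.pi * n) with h1 | h1
    · rw [e, clampR_of_le (by linarith)]
      simpa using ih h1
    · rw [e, stair_top α hα n s h1]
      have h2 := clampR_nonneg (s - α - 2 * Real.pi * n)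
      have h3 := clampR_le_one (s - α - 2 * Real.pi * n)
      push_cast at hs
      rw [abs_le]
      constructor <;> nlinarith

/-- Approximate commutation on one of the two classes. -/
lemma tom_approx {A : Type*} [CStarAlgebra A] (B : StarSubalgebra ℂ A)
    (hBclosed : IsClosed (B : Set A)) (E : A →ₗ[ℂ] A)
    (hE_mem : ∀ a : A, E a ∈ B) (hE_id : ∀ b ∈ B, E b = b) (hE_norm : ∀ a : A, ‖E a‖ ≤ ‖a‖)
    (h : A) (hh : IsSelfAdjoint h) (hB : h ∈ B) (hpos : ∀ s ∈ spectrum ℝ h, 0 ≤ s)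
    (α : ℝ) (h0 : 0 ≤ α) (hα : α ≤ Real.pi) (f : ℝ → ℝ) (hf : Continuous f)
    (hf1 : ∀ s, |f s| ≤ 1)
    (hfz : ∀ i : ℕ, ∀ r : ℝ, 0 ≤ r → r ≤ 1 → f (r + α + 2 * Real.pi * i) = 0) (x : A) :
    ‖h * E (cfc f h * x) - E (h * (cfc f h * x))‖ ≤ 4 * Real.pi * ‖x‖ := by
  have hpi := Real.pi_gt_three
  obtain ⟨n, hn⟩ := exists_nat_ge (‖h‖ * ‖(1 : A)‖)
  set w := cfc f h * x with hw
  have hwx : ‖w‖ ≤ ‖x‖ := by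
    have h1 : ‖cfc f h‖ ≤ 1 := norm_cfc_le zero_le_one fun s _ => hf1 s
    have := mul_le_mul_of_nonneg_right h1 (norm_nonneg x)
    linarith [norm_mul_le (cfc f h) x]
  have hcc : ∀ i : ℕ, Continuous fun s => clampR (s - α - 2 * Real.pi * i) :=
    fun i => clampR_cont.comp (by fun_prop)
  have hKc : Continuous (stair α n) := by
    unfold stair
    exact continuous_finsetSum _ fun i _ => continuous_const.mul (hcc i)
  have hK : cfc (stair α n) h =
      ∑ i ∈ Finset.range n, (2 * Real.pi) • cfc (fun s => clampR (s - α - 2 * Real.pi * i)) h := by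
    have : stair α n = ∑ i ∈ Finset.range n,
        fun s => 2 * Real.pi * clampR (s - α - 2 * Real.pi * i) := by
      ext s; simp [stair]
    rw [this, cfc_sum (fun (i : ℕ) s => 2 * Real.pi * clampR (s - α - 2 * Real.pi * i)) h _
      fun i _ => (continuous_const.mul (hcc i)).continuousOn]
    refine Finset.sum_congr rfl fun i _ => ?_
    rw [cfc_const_mul _ _ h (hcc i).continuousOn]
  have hcomm : cfc (stair α n) h * E w = E (cfc (stair α n) h * w) := by
    rw [hK, Finset.sum_mul, Finset.sum_mul, map_sum]
    refine Finset.sum_congr rfl fun i _ => ?_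
    rw [smul_mul_assoc, smul_mul_assoc, LinearMap.map_smul_of_tower]
    congr 1
    refine tom_comm B hBclosed E hE_mem hE_id hE_norm h hh hB f _ hf (hcc i) ?_ x
    intro s
    rcases le_total (s - α - 2 * Real.pi * i) 0 with h1 | h1
    · simp [clampR_of_le h1]
    rcases le_total 1 (s - α - 2 * Real.pi * i) with h2 | h2
    · simp [clampR_of_ge h2]
    have := hfz i _ h1 h2
    rw [show s - α - 2 * Real.pi * i + α + 2 * Real.pi * i = s by ring] at this
    simp [this]
  have hd : ‖h - cfc (stair α n) h‖ ≤ 2 * Real.pi := by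
    have e : h - cfc (stair α n) h = cfc (fun s => s - stair α n s) h := by
      rw [cfc_sub (fun s => s) _ h continuousOn_id hKc.continuousOn, cfc_id' ℝ h]
    rw [e]
    refine norm_cfc_le (by positivity) fun s hs => ?_
    refine stair_bound α h0 hα n s (hpos s hs) ?_
    have h1 := spectrum.norm_le_norm_mul_of_mem hs
    rw [Real.norm_of_nonneg (hpos s hs)] at h1
    nlinarith [(Nat.cast_nonneg n : (0:ℝ) ≤ n)]
  have e : h * E w - E (h * w) =
      (h - cfc (stair α n) h) * E w - E ((h - cfc (stair α n) h) * w) := by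
    rw [sub_mul, sub_mul, map_sub, hcomm]; abel
  rw [e]
  have b1 : ‖(h - cfc (stair α n) h) * E w‖ ≤ 2 * Real.pi * ‖x‖ :=
    (norm_mul_le _ _).trans (mul_le_mul hd ((hE_norm w).trans hwx) (norm_nonneg _) (by positivity))
  have b2 : ‖E ((h - cfc (stair α n) h) * w)‖ ≤ 2 * Real.pi * ‖x‖ :=
    (hE_norm _).trans
      ((norm_mul_le _ _).trans (mul_le_mul hd hwx (norm_nonneg _) (by positivity)))
  linarith [norm_sub_le ((h - cfc (stair α n) h) * E w) (E ((h - cfc (stair α n) h) * w))]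

lemma tom_approx2 {A : Type*} [CStarAlgebra A] (B : StarSubalgebra ℂ A)
    (hBclosed : IsClosed (B : Set A)) (E : A →ₗ[ℂ] A)
    (hE_mem : ∀ a : A, E a ∈ B) (hE_id : ∀ b ∈ B, E b = b) (hE_norm : ∀ a : A, ‖E a‖ ≤ ‖a‖)
    (h : A) (hh : IsSelfAdjoint h) (hB : h ∈ B) (hpos : ∀ s ∈ spectrum ℝ h, 0 ≤ s) (x : A) :
    ‖h * E x - E (h * x)‖ ≤ 8 * Real.pi * ‖x‖ := by
  let f : ℝ → ℝ := fun s => clampR (1 / 2 + Real.cos s)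
  have hf : Continuous f := clampR_cont.comp (by fun_prop)
  have hcos : ∀ r : ℝ, 0 ≤ r → r ≤ 1 → 1 / 2 ≤ Real.cos r := by
    intro r h0 h1
    have := Real.one_sub_sq_div_two_le_cos (x := r)
    nlinarith
  have hper : ∀ (r : ℝ) (i : ℕ), Real.cos (r + 2 * Real.pi * i) = Real.cos r := by
    intro r i
    rw [mul_comm]; exact Real.cos_add_nat_mul_two_pi r i
  have hf0 : ∀ s, 0 ≤ f s := fun s => clampR_nonneg _
  have hf1 : ∀ s, f s ≤ 1 := fun s => clampR_le_one _
  have a1 := tom_approx B hBclosed E hE_mem hE_id hE_norm h hh hB hpos Real.pi Real.pi_pos.le le_rfl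
    f hf (fun s => abs_le.2 ⟨by linarith [hf0 s], hf1 s⟩) (fun i r r0 r1 => by
      apply clampR_of_le
      rw [hper, Real.cos_add_pi]; linarith [hcos r r0 r1]) x
  have a2 := tom_approx B hBclosed E hE_mem hE_id hE_norm h hh hB hpos 0 le_rfl Real.pi_pos.le
    (fun s => 1 - f s) (by fun_prop)
    (fun s => abs_le.2 ⟨by linarith [hf1 s], by linarith [hf0 s]⟩) (fun i r r0 r1 => by
      have : f (r + 0 + 2 * Real.pi * i) = 1 := by
        apply clampR_of_ge
        rw [hper, add_zero]; linarith [hcos r r0 r1]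
      simp only [this, sub_self]) x
  have e3 : cfc (fun s => 1 - f s) h = 1 - cfc f h := by
    rw [cfc_sub _ _ h continuousOn_const hf.continuousOn, cfc_const_one ℝ h]
  rw [e3] at a2
  have e : h * E x - E (h * x) = (h * E (cfc f h * x) - E (h * (cfc f h * x))) +
      (h * E ((1 - cfc f h) * x) - E (h * ((1 - cfc f h) * x))) := by
    simp only [sub_mul, one_mul, map_sub, mul_sub]; abel
  rw [e]
  linarith [norm_add_le (h * E (cfc f h * x) - E (h * (cfc f h * x)))
      (h * E ((1 - cfc f h) * x) - E (h * ((1 - cfc f h) * x)))]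

lemma tom_sa {A : Type*} [CStarAlgebra A] (B : StarSubalgebra ℂ A)
    (hBclosed : IsClosed (B : Set A)) (E : A →ₗ[ℂ] A)
    (hE_mem : ∀ a : A, E a ∈ B) (hE_id : ∀ b ∈ B, E b = b) (hE_norm : ∀ a : A, ‖E a‖ ≤ ‖a‖)
    (h : A) (hh : IsSelfAdjoint h) (hB : h ∈ B) (x : A) :
    E (h * x) = h * E x := by
  set R := ‖h‖ * ‖(1 : A)‖ with hR
  have key : ∀ n : ℕ, (n : ℝ) * ‖h * E x - E (h * x)‖ ≤ 8 * Real.pi * ‖x‖ := by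
    intro n
    have hc : Continuous fun s : ℝ => (n : ℝ) * (s + R) := by fun_prop
    have e1 : cfc (fun s : ℝ => (n : ℝ) * (s + R)) h = (n : ℝ) • (h + R • (1 : A)) := by
      rw [cfc_const_mul _ _ h (by fun_prop), cfc_add _ _ _ (by fun_prop) (by fun_prop),
        cfc_id' ℝ h, cfc_const R h, Algebra.algebraMap_eq_smul_one]
    have := tom_approx2 B hBclosed E hE_mem hE_id hE_norm
      (cfc (fun s : ℝ => (n : ℝ) * (s + R)) h) (cfc_predicate _ h)
      (cfc_mem (𝕜' := ℂ) (hs := hBclosed) _ hB) (by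
        rw [cfc_map_spectrum _ h hh hc.continuousOn]
        rintro _ ⟨s, hs, rfl⟩
        have h1 := spectrum.norm_le_norm_mul_of_mem hs
        have h2 := (abs_le.1 (Real.norm_eq_abs s ▸ h1)).1
        have : 0 ≤ s + R := by linarith
        simp only
        positivity) x
    rw [e1] at this
    have e2 : ((n : ℝ) • (h + R • (1 : A))) * E x - E (((n : ℝ) • (h + R • (1 : A))) * x)
        = (n : ℝ) • (h * E x - E (h * x)) := by
      simp only [smul_mul_assoc, add_mul, one_mul, LinearMap.map_smul_of_tower, map_add]
      rw [← smul_sub]; congr 1; abel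
    rw [e2, norm_smul, Real.norm_of_nonneg (by positivity)] at this
    exact this
  have hz : ‖h * E x - E (h * x)‖ = 0 := by
    by_contra hne
    have hp : 0 < ‖h * E x - E (h * x)‖ := lt_of_le_of_ne (norm_nonneg _) (Ne.symm hne)
    obtain ⟨n, hn⟩ := exists_nat_gt (8 * Real.pi * ‖x‖ / ‖h * E x - E (h * x)‖)
    rw [div_lt_iff₀ hp] at hn
    linarith [key n]
  exact (sub_eq_zero.1 (norm_eq_zero.1 hz)).symm

open scoped ComplexStarModule in
lemma tom_module {A : Type*} [CStarAlgebra A] (B : StarSubalgebra ℂ A)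
    (hBclosed : IsClosed (B : Set A)) (E : A →ₗ[ℂ] A)
    (hE_mem : ∀ a : A, E a ∈ B) (hE_id : ∀ b ∈ B, E b = b) (hE_norm : ∀ a : A, ‖E a‖ ≤ ‖a‖)
    (b : A) (hB : b ∈ B) (x : A) :
    E (b * x) = b * E x := by
  have hs : star b ∈ B := star_mem hB
  have h1 := tom_sa B hBclosed E hE_mem hE_id hE_norm (b + star b) (IsSelfAdjoint.add_star_self b)
    (B.add_mem hB hs) x
  have h2 := tom_sa B hBclosed E hE_mem hE_id hE_norm (Complex.I • (b - star b))
    (by simp [IsSelfAdjoint, smul_sub]; abel) (B.smul_mem (B.sub_mem hB hs) _) x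
  simp only [smul_mul_assoc, map_smul] at h2
  have h3 := smul_right_injective A Complex.I_ne_zero h2
  simp only [add_mul, sub_mul, map_add, map_sub] at h1 h3
  have h4 : (2 : ℂ) • E (b * x) = (2 : ℂ) • (b * E x) := by
    rw [two_smul, two_smul]
    calc E (b * x) + E (b * x) = (E (b * x) + E (star b * x)) + (E (b * x) - E (star b * x)) := by abel
      _ = _ := by rw [h1, h3]; abel
  exact smul_right_injective A (two_ne_zero) h4

/-- For a unital C*-algebra `A` with faithful state `φ`, a C*-subalgebra `B`,
and a norm-one projection `E : A → B` with `φ ∘ E = φ`, the kernel of `E` equals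
`A ⊖ B = {a | ∀ d ∈ B, φ (d * a) = 0}`. -/
theorem ker_condExp_eq_ominus
    {A : Type*} [CStarAlgebra A]
    (B : StarSubalgebra ℂ A) (hBclosed : IsClosed (B : Set A))
    (φ : A →ₗ[ℂ] ℂ)
    (hφ_state : φ 1 = 1)
    (hφ_pos : ∀ a : A, 0 ≤ (φ (star a * a)).re ∧ (φ (star a * a)).im = 0)
    (hφ_faithful : ∀ a : A, φ (star a * a) = 0 → a = 0)
    (E : A →ₗ[ℂ] A)
    (hE_mem : ∀ a : A, E a ∈ B)
    (hE_id : ∀ b ∈ B, E b = b)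
    (hE_norm : ∀ a : A, ‖E a‖ ≤ ‖a‖)
    (hφE : ∀ a : A, φ (E a) = φ a) :
    {a : A | E a = 0} = {a : A | ∀ d ∈ B, φ (d * a) = 0} := by
  have hmod := tom_module B hBclosed E hE_mem hE_id hE_norm
  ext a
  simp only [Set.mem_ofPred_eq]
  constructor
  · intro ha d hd
    rw [← hφE, hmod d hd, ha, mul_zero, map_zero]
  · intro ha
    apply hφ_faithful
    have hs : star (E a) ∈ B := star_mem (hE_mem a)
    rw [← hmod _ hs, hφE]
    exact ha _ hs
end

section
/- (Tomiyama) Let A be a C*-algebra, B ⊆ A a C*-subalgebra, and E : A → B a linear idempotent with E|_B = id and ‖E(a)‖ ≤ ‖a‖ for all a. Then E is positive: a ≥ 0 implies E(a) ≥ 0. -/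
open scoped ContinuousMapZero

lemma tom_extend {F V : Type*} [NormedAddCommGroup F] [NormedSpace ℂ F]
    [NormedAddCommGroup V] [NormedSpace ℂ V] (i : F →ₗᵢ[ℂ] V) (f : F →ₗ[ℂ] ℂ)
    (hf : ∀ x, ‖f x‖ ≤ ‖x‖) :
    ∃ g : V →ₗ[ℂ] ℂ, (∀ y, ‖g y‖ ≤ ‖y‖) ∧ ∀ x, g (i x) = f x := by
  let φ : StrongDual ℂ (LinearMap.range i.toLinearMap) :=
    LinearMap.mkContinuous (f ∘ₗ i.equivRange.symm.toLinearEquiv.toLinearMap) 1 (by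
      intro x
      have h := hf (i.equivRange.symm x)
      rw [LinearIsometryEquiv.norm_map] at h
      simpa using h)
  obtain ⟨g, hg, hn⟩ := exists_extension_norm_eq _ φ
  have hφ : ‖φ‖ ≤ 1 := LinearMap.mkContinuous_norm_le _ zero_le_one _
  refine ⟨g.toLinearMap, fun y => ?_, fun x => ?_⟩
  · have := g.le_of_opNorm_le (hn.trans_le hφ) y
    simpa using this
  · have h := hg (i.equivRange x)
    have h2 : φ (i.equivRange x) = f (i.equivRange.symm (i.equivRange x)) := rfl
    rw [LinearIsometryEquiv.symm_apply_apply] at h2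
    exact h.trans h2

lemma tom_norm {U : Type*} [CStarAlgebra U] [PartialOrder U] [StarOrderedRing U]
    (y : U) (hy : 0 ≤ y) (r : ℝ) (hr : ‖y‖ ≤ r) :
    ‖(2 : ℂ) • y - (r : ℂ) • (1 : U)‖ ≤ r := by
  have hr0 : 0 ≤ r := (norm_nonneg _).trans hr
  have hsa : IsSelfAdjoint y := .of_nonneg hy
  have h : (2 : ℂ) • y - (r : ℂ) • (1 : U) = cfc (fun t : ℝ => 2 * t - r) y := by
    rw [cfc_sub _ _ y, cfc_const_mul _ _ y, cfc_id' ℝ y, cfc_const _ y,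
      Algebra.algebraMap_eq_smul_one, Complex.coe_smul, ← Complex.coe_smul 2 y]
    simp
  rw [h]
  refine norm_cfc_le hr0 fun t ht => ?_
  have h0 : 0 ≤ t := spectrum_nonneg_of_nonneg hy ht
  have h1 : ‖t‖ ≤ ‖y‖ := by
    rcases subsingleton_or_nontrivial U with _ | _
    · rw [spectrum.of_subsingleton] at ht
      exact ht.elim
    exact spectrum.norm_le_norm_of_mem ht
  rw [Real.norm_eq_abs] at *
  rw [abs_le] at *
  constructor <;> linarith

lemma tom_norm_im {U : Type*} [CStarAlgebra U]
    (y : U) (hy : IsSelfAdjoint y) (t : ℝ) :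
    ‖y + (Complex.I * t) • (1 : U)‖ ^ 2 ≤ ‖y‖ ^ 2 + t ^ 2 := by
  rcases subsingleton_or_nontrivial U with _ | _
  · have : y + (Complex.I * t) • (1 : U) = 0 := Subsingleton.elim _ _
    rw [this]; simp; positivity
  rw [sq, ← CStarRing.norm_star_mul_self]
  have : star (y + (Complex.I * t) • (1 : U)) * (y + (Complex.I * t) • (1 : U))
      = y * y + ((t : ℂ) ^ 2) • (1 : U) := by
    simp only [star_add, hy.star_eq, star_smul, star_one, add_mul, mul_add, smul_mul_assoc,
      mul_smul_comm, one_mul, mul_one]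
    have e1 : star (Complex.I * (t : ℂ)) = - (Complex.I * t) := by simp
    rw [e1]
    have e2 : -(Complex.I * (t : ℂ)) * (Complex.I * t) = (t : ℂ) ^ 2 := by
      linear_combination (-(t : ℂ) ^ 2) * Complex.I_sq
    have e3 : (Complex.I * (t : ℂ)) * -(Complex.I * t) = (t : ℂ) ^ 2 := by
      linear_combination (-(t : ℂ) ^ 2) * Complex.I_sq
    rw [← e3, mul_smul (Complex.I * (t : ℂ)) (-(Complex.I * (t : ℂ))) (1 : U), smul_add, neg_smul, neg_smul]
    abel
  rw [this]
  refine (norm_add_le _ _).trans ?_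
  have h1 : ‖y * y‖ ≤ ‖y‖ ^ 2 := by rw [sq]; exact norm_mul_le _ _
  have h2 : ‖((t : ℂ) ^ 2) • (1 : U)‖ = t ^ 2 := by
    rw [norm_smul]; simp
  linarith

/-- A contractive functional attaining the value one at a positive contraction is positive. -/
lemma tom_pos {A : Type*} [NonUnitalCStarAlgebra A] [PartialOrder A] [StarOrderedRing A]
    (f : A →ₗ[ℂ] ℂ) (hf : ∀ x, ‖f x‖ ≤ ‖x‖) (e : A) (he : 0 ≤ e) (he1 : ‖e‖ ≤ 1)
    (hfe : f e = 1) :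
    (∀ a, IsSelfAdjoint a → (f a).im = 0) ∧ ∀ a, 0 ≤ a → 0 ≤ (f a).re := by
  let i : A →ₗᵢ[ℂ] Unitization ℂ A :=
    { toLinearMap := Unitization.inrHom ℂ ℂ A
      norm_map' := fun x => Unitization.norm_inr (𝕜 := ℂ) x }
  obtain ⟨g, hg, hgi⟩ := tom_extend i f hf
  have hi : ∀ a : A, g (a : Unitization ℂ A) = f a := hgi
  have key : ∀ a : A, 0 ≤ a → ∀ r : ℝ, ‖a‖ ≤ r → ‖2 * f a - r * g 1‖ ≤ r := by
    intro a ha r hr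
    have h := (hg _).trans (tom_norm (a : Unitization ℂ A) (Unitization.inr_nonneg_iff.2 ha) r
      (by rwa [Unitization.norm_inr]))
    rwa [map_sub, map_smul, map_smul, hi, smul_eq_mul, smul_eq_mul] at h
  have g1 : g 1 = 1 := by
    have h1 := key e he 1 he1
    have h2 : ‖g 1‖ ≤ 1 := (hg 1).trans (by
      simp)
    rw [hfe] at h1
    have h3 : ‖(2 : ℂ) * 1 - (1 : ℝ) * g 1‖ ^ 2 ≤ 1 := by
      exact pow_le_one₀ (norm_nonneg _) h1
    have h4 : ‖g 1‖ ^ 2 ≤ 1 := pow_le_one₀ (norm_nonneg _) h2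
    rw [← Complex.normSq_eq_norm_sq, Complex.normSq_apply] at h3 h4
    simp at h3
    apply Complex.ext
    · simp; nlinarith [sq_nonneg ((g 1).re - 1), sq_nonneg (g 1).im]
    · simp; nlinarith [sq_nonneg ((g 1).re - 1), sq_nonneg (g 1).im]
  constructor
  · intro a ha
    have h : ∀ t : ℝ, ((f a).im + t) ^ 2 ≤ ‖a‖ ^ 2 + t ^ 2 := by
      intro t
      have h1 := tom_norm_im (a : Unitization ℂ A) (ha.inr ℂ) t
      have h2 := hg ((a : Unitization ℂ A) + (Complex.I * t) • (1 : Unitization ℂ A))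
      rw [map_add, map_smul, hi, g1] at h2
      have h3 := (pow_le_pow_left₀ (norm_nonneg _) h2 2).trans h1
      rw [← Complex.normSq_eq_norm_sq, Complex.normSq_apply, Unitization.norm_inr] at h3
      simp at h3
      nlinarith [sq_nonneg (f a).re]
    by_contra hne
    have h1 := h (‖a‖ ^ 2 / (f a).im)
    have h2 : (f a).im * (‖a‖ ^ 2 / (f a).im) = ‖a‖ ^ 2 := by field_simp
    have h3 : 0 < (f a).im ^ 2 := by positivity
    nlinarith [sq_nonneg ‖a‖]
  · intro a ha
    have h := key a ha ‖a‖ le_rfl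
    rw [g1] at h
    have h2 := (Complex.abs_re_le_norm _).trans h
    simp at h2
    have := (abs_le.1 h2).1
    linarith

lemma tom_state {A : Type*} [NonUnitalCStarAlgebra A] [PartialOrder A] [StarOrderedRing A]
    (B : NonUnitalStarSubalgebra ℂ A) (hBclosed : IsClosed (B : Set A))
    (k : A) (hkB : k ∈ B) (hk : IsSelfAdjoint k) (c : ℝ) (hc : c ∈ quasispectrum ℝ k)
    (hc0 : c ≠ 0) :
    ∃ (g : A →ₗ[ℂ] ℂ) (e : A), (∀ x, ‖g x‖ ≤ ‖x‖) ∧ 0 ≤ e ∧ ‖e‖ ≤ 1 ∧ e ∈ B ∧ g e = 1 ∧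
      g k = c := by
  have hn : IsStarNormal k := hk.isStarNormal
  have hcC : (c : ℂ) ∈ quasispectrum ℂ k := quasispectrum.algebraMap_mem ℂ hc
  let i : C(quasispectrum ℂ k, ℂ)₀ →ₗᵢ[ℂ] A :=
    { toLinearMap := (cfcₙHom (R := ℂ) hn : C(quasispectrum ℂ k, ℂ)₀ →ₗ[ℂ] A)
      norm_map' := fun x => norm_cfcₙHom k x hn }
  let φ : C(quasispectrum ℂ k, ℂ)₀ →ₗ[ℂ] ℂ :=
    { toFun := fun f => f ⟨c, hcC⟩
      map_add' := fun _ _ => rfl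
      map_smul' := fun _ _ => rfl }
  obtain ⟨g, hg, hgi⟩ := tom_extend i φ (fun f => by
    exact ContinuousMap.norm_coe_le_norm (f : C(quasispectrum ℂ k, ℂ)) ⟨c, hcC⟩)
  have hi : ∀ f : ℂ → ℂ, Continuous f → f 0 = 0 → g (cfcₙ f k) = f c := by
    intro f hf hf0
    rw [cfcₙ_apply f k hf.continuousOn hf0 hn]
    exact hgi _
  let ψ : ℝ → ℝ := fun x => min 1 (|x| / |c|)
  have hψ : Continuous ψ := by fun_prop
  have hψ0 : ψ 0 = 0 := by simp [ψ]
  have hψc : ψ c = 1 := by simp [ψ, hc0]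
  have hψn : ∀ x, 0 ≤ ψ x := fun x => by positivity
  refine ⟨g, cfcₙ ψ k, hg, cfcₙ_nonneg fun x _ => hψn x, ?_, ?_, ?_, ?_⟩
  · refine norm_cfcₙ_le fun x _ => ?_
    rw [Real.norm_of_nonneg (hψn x)]
    exact min_le_left _ _
  · have : IsClosed (B : Set A) := hBclosed
    exact cfcₙ_mem (𝕜 := ℝ) (𝕜' := ℂ) ψ hkB
  · rw [cfcₙ_real_eq_complex, hi _ (by fun_prop) (by simp [hψ0])]
    simp [hψc]
  · conv_lhs => rw [← cfcₙ_id' ℂ k]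
    rw [hi _ (by fun_prop) rfl]

/-- Tomiyama: a norm-one projection `E : A → B` onto a C*-subalgebra is
positive: `0 ≤ a → 0 ≤ E a`. -/
theorem tomiyama_positive
    {A : Type*} [NonUnitalCStarAlgebra A] [PartialOrder A] [StarOrderedRing A]
    (B : NonUnitalStarSubalgebra ℂ A) (hBclosed : IsClosed (B : Set A))
    (E : A →ₗ[ℂ] A)
    (hE_mem : ∀ a : A, E a ∈ B)
    (hE_id : ∀ b ∈ B, E b = b)
    (hE_norm : ∀ a : A, ‖E a‖ ≤ ‖a‖) :
    ∀ a : A, 0 ≤ a → 0 ≤ E a := by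
  intro a ha
  have hrB : ((realPart (E a) : selfAdjoint A) : A) ∈ B := by
    rw [realPart_apply_coe, ← Complex.coe_smul]
    exact SMulMemClass.smul_mem _ (add_mem (hE_mem a) (star_mem (hE_mem a)))
  have hiB : ((imaginaryPart (E a) : selfAdjoint A) : A) ∈ B := by
    rw [imaginaryPart_apply_coe, ← Complex.coe_smul (2⁻¹ : ℝ)]
    exact SMulMemClass.smul_mem _ (SMulMemClass.smul_mem _ (sub_mem (hE_mem a) (star_mem (hE_mem a))))
  have hdec := realPart_add_I_smul_imaginaryPart (E a)
  have him : ((imaginaryPart (E a) : selfAdjoint A) : A) = 0 := by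
    set k : A := ((imaginaryPart (E a) : selfAdjoint A) : A) with hkdef
    have hk : IsSelfAdjoint k := (imaginaryPart (E a)).2
    have hz : ∀ c ∈ quasispectrum ℝ k, c = 0 := by
      intro c hc
      by_contra hc0
      obtain ⟨g, e, hg, he, he1, heB, hge, hgk⟩ := tom_state B hBclosed k hiB hk c hc hc0
      have p1 := (tom_pos g hg e he he1 hge).1 _ (realPart (E a)).2
      have p2 := (tom_pos (g ∘ₗ E) (fun x => (hg _).trans (hE_norm x)) e he he1
        (by simp [hE_id e heB, hge])).1 a (.of_nonneg ha)
      rw [LinearMap.comp_apply, ← hdec, map_add, map_smul, hgk] at p2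
      rw [Complex.add_im, p1] at p2
      simp at p2
      exact hc0 p2
    rw [← cfcₙ_id' ℝ k, cfcₙ_congr (g := fun _ => 0) (fun x hx => hz x hx), cfcₙ_const_zero]
  have hsa : IsSelfAdjoint (E a) := by
    rw [← hdec, him, smul_zero, add_zero]
    exact (realPart (E a)).2
  rw [StarOrderedRing.nonneg_iff_quasispectrum_nonneg (R := ℝ) (E a)]
  intro c hc
  by_contra hneg
  push Not at hneg
  obtain ⟨g, e, hg, he, he1, heB, hge, hgk⟩ :=
    tom_state B hBclosed (E a) (hE_mem a) hsa c hc hneg.ne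
  have p2 := (tom_pos (g ∘ₗ E) (fun x => (hg _).trans (hE_norm x)) e he he1
    (by simp [hE_id e heB, hge])).2 a ha
  rw [LinearMap.comp_apply, hgk] at p2
  simp at p2
  linarith
end

section
/- (Tomiyama) Let A be a C*-algebra, B ⊆ A a C*-subalgebra, and E : A → B a projection of norm one. Then E is B-bimodular: E(b₁ a b₂) = b₁ E(a) b₂ for all a ∈ A and b₁, b₂ ∈ B. -/
structure TomSetup (C : Type*) [CStarAlgebra C] where
  A : NonUnitalStarSubalgebra ℂ C
  B : NonUnitalStarSubalgebra ℂ C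
  E : C →L[ℂ] C
  G : C
  hBA : ∀ b ∈ B, b ∈ A
  hBcl : IsClosed (B : Set C)
  hEB : ∀ a ∈ A, E a ∈ B
  hid : ∀ b ∈ B, E b = b
  hG : star G = G
  hGn : ‖G‖ ≤ 1
  hGA : ∀ a ∈ A, G * a = a
  hcon : ∀ a ∈ A, ‖G + E a‖ ≤ ‖G + a‖

namespace TomSetup

variable {C : Type*} [CStarAlgebra C] (S : TomSetup C)

/-- unitaries congruent to one -/
structure U (u : C) : Prop where
  l : star u * u = 1
  r : u * star u = 1
  m : u - 1 ∈ S.B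

variable {S}

theorem hAG {a : C} (ha : a ∈ S.A) : a * S.G = a := by
  have := congrArg star (S.hGA (star a) (star_mem ha))
  simpa [S.hG] using this

theorem U.one : S.U 1 := ⟨by simp, by simp, by simp⟩

theorem U.star {u : C} (hu : S.U u) : S.U (star u) :=
  ⟨by simpa using hu.r, by simpa using hu.l, by simpa using star_mem hu.m⟩

theorem U.mulA {u a : C} (hu : S.U u) (ha : a ∈ S.A) : u * a ∈ S.A := by
  have : u * a = (u - 1) * a + a := by noncomm_ring
  rw [this]; exact add_mem (mul_mem (S.hBA _ hu.m) ha) ha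

theorem U.Amul {u a : C} (hu : S.U u) (ha : a ∈ S.A) : a * u ∈ S.A := by
  have : a * u = a * (u - 1) + a := by noncomm_ring
  rw [this]; exact add_mem (mul_mem ha (S.hBA _ hu.m)) ha

theorem U.mulB {u a : C} (hu : S.U u) (ha : a ∈ S.B) : u * a ∈ S.B := by
  have : u * a = (u - 1) * a + a := by noncomm_ring
  rw [this]; exact add_mem (mul_mem hu.m ha) ha

theorem U.Bmul {u a : C} (hu : S.U u) (ha : a ∈ S.B) : a * u ∈ S.B := by
  have : a * u = a * (u - 1) + a := by noncomm_ring
  rw [this]; exact add_mem (mul_mem ha hu.m) ha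

theorem U.mul {u v : C} (hu : S.U u) (hv : S.U v) : S.U (u * v) := by
  refine ⟨?_, ?_, ?_⟩
  · rw [star_mul, mul_assoc, ← mul_assoc (Star.star u), hu.l, one_mul, hv.l]
  · rw [star_mul, mul_assoc, ← mul_assoc v, hv.r, one_mul, hu.r]
  · have : u * v - 1 = u * (v - 1) + (u - 1) := by noncomm_ring
    rw [this]; exact add_mem (hu.mulB hv.m) hu.m

theorem U.norm_mul {u : C} (hu : S.U u) (a : C) : ‖u * a‖ = ‖a‖ :=
  CStarRing.norm_mem_unitary_mul a (Unitary.mem_iff.2 ⟨hu.l, hu.r⟩)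

theorem U.mul_norm {u : C} (hu : S.U u) (a : C) : ‖a * u‖ = ‖a‖ :=
  CStarRing.norm_mul_mem_unitary a (Unitary.mem_iff.2 ⟨hu.l, hu.r⟩)

theorem skew_norm {u z : C} (hu : S.U u) (hz : z ∈ S.A) (s : ℝ) :
    ‖S.G + s • (star u * S.E (u * z))‖ ≤ ‖S.G + s • z‖ := by
  have h1 : u * S.G = S.G + (u - 1) := by
    have := hAG (S.hBA _ hu.m)
    rw [sub_mul, one_mul] at this
    rw [← this]; abel
  have hm : (u - 1) + s • (u * z) ∈ S.A := by
    refine add_mem (S.hBA _ hu.m) ?_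
    rw [← Complex.coe_smul]
    exact SMulMemClass.smul_mem _ (hu.mulA hz)
  have h2 := S.hcon _ hm
  rw [map_add, S.hid _ hu.m, ← add_assoc, ← add_assoc, ← h1] at h2
  rw [← hu.norm_mul (S.G + s • (Star.star u * S.E (u * z))), ← hu.norm_mul (S.G + s • z),
    mul_add, mul_add, mul_smul_comm, ← mul_assoc, hu.r, one_mul, mul_smul_comm]
  rwa [S.E.map_smul_of_tower] at h2

theorem skew_pres {u z : C} (hu : S.U u) (hz : z ∈ S.A) (hs : star z = -z) :
    star (star u * S.E (u * z)) = -(star u * S.E (u * z)) := by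
  let _ := CStarAlgebra.spectralOrder C
  have _ := CStarAlgebra.spectralOrderedRing C
  set x := star u * S.E (u * z) with hx
  have hxB : x ∈ S.B := hu.star.mulB (S.hEB _ (hu.mulA hz))
  set q := x + star x with hq
  have hqB : q ∈ S.B := add_mem hxB (star_mem hxB)
  have hqs : star q = q := by simp [hq, add_comm]
  have hqG : q * S.G = q := hAG (S.hBA _ hqB)
  have hGq : S.G * q = q := S.hGA _ (S.hBA _ hqB)
  have hGx : S.G * x = x := S.hGA _ (S.hBA _ hxB)
  have hxG : star x * S.G = star x := hAG (S.hBA _ (star_mem hxB))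
  have hsk : ∀ s : ℝ, ‖S.G + s • x‖ ≤ ‖S.G + s • z‖ := fun s => skew_norm hu hz s
  clear_value q x
  have key : ∀ s : ℝ, s • (q * q * q) ≤ (s ^ 2 * ‖z‖ ^ 2) • (q * q) := by
    intro s
    have h1 : ‖S.G + s • z‖ ^ 2 ≤ 1 + s ^ 2 * ‖z‖ ^ 2 := by
      rw [sq, ← CStarRing.norm_star_mul_self]
      have : star (S.G + s • z) * (S.G + s • z) = S.G * S.G - s ^ 2 • (z * z) := by
        simp only [star_add, star_smul, S.hG, hs, star_trivial, add_mul, mul_add, smul_neg,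
          neg_mul, mul_smul_comm, smul_mul_assoc, S.hGA z hz, hAG hz, smul_smul, smul_add, sq]
        abel
      rw [this]
      refine (norm_sub_le _ _).trans ?_
      have e1 : ‖S.G * S.G‖ ≤ 1 :=
        (norm_mul_le _ _).trans (by nlinarith [S.hGn, norm_nonneg S.G])
      have e2 : ‖s ^ 2 • (z * z)‖ ≤ s ^ 2 * ‖z‖ ^ 2 := by
        rw [norm_smul, Real.norm_of_nonneg (sq_nonneg s), sq ‖z‖]
        gcongr; exact norm_mul_le _ _
      linarith
    have h2 : ‖S.G + s • x‖ ^ 2 ≤ 1 + s ^ 2 * ‖z‖ ^ 2 :=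
      (pow_le_pow_left₀ (norm_nonneg _) (hsk s) 2).trans h1
    have h3 : star (S.G + s • x) * (S.G + s • x) ≤ (1 + s ^ 2 * ‖z‖ ^ 2) • (1 : C) := by
      refine (CStarAlgebra.star_mul_le_algebraMap_norm_sq).trans ?_
      rw [← Algebra.algebraMap_eq_smul_one]
      exact algebraMap_mono _ h2
    have h4 : star (S.G + s • x) * (S.G + s • x) = S.G * S.G + s • q + s ^ 2 • (star x * x) := by
      simp only [star_add, star_smul, S.hG, star_trivial, add_mul, mul_add,
        mul_smul_comm, smul_mul_assoc, hGx, hxG, smul_smul, sq, hq, smul_add]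
      abel
    have h5 : S.G * S.G + s • q ≤ (1 + s ^ 2 * ‖z‖ ^ 2) • (1 : C) := by
      rw [h4] at h3
      exact (le_add_of_nonneg_right (smul_nonneg (sq_nonneg s) (star_mul_self_nonneg x))).trans h3
    have h6 := star_left_conjugate_le_conjugate h5 q
    rw [hqs] at h6
    have e1 : q * (S.G * S.G + s • q) * q = q * q + s • (q * q * q) := by
      rw [mul_add, add_mul, ← mul_assoc, hqG, hqG, mul_smul_comm, smul_mul_assoc]
    have e2 : q * ((1 + s ^ 2 * ‖z‖ ^ 2) • (1 : C)) * q
        = q * q + (s ^ 2 * ‖z‖ ^ 2) • (q * q) := by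
      rw [mul_smul_comm, mul_one, smul_mul_assoc, add_smul, one_smul]
    rw [e1, e2] at h6
    exact le_of_add_le_add_left h6
  have lim : ∀ y : C, (∀ s : ℝ, 0 < s → y ≤ s • (‖z‖ ^ 2 • (q * q))) → y ≤ 0 := by
    intro y hy
    have ht : Filter.Tendsto (fun s : ℝ => s • (‖z‖ ^ 2 • (q * q))) (nhdsWithin 0 (Set.Ioi 0))
        (nhds 0) := by
      have : Continuous (fun s : ℝ => s • (‖z‖ ^ 2 • (q * q))) := by fun_prop
      have := this.tendsto 0
      rw [zero_smul] at this
      exact this.mono_left nhdsWithin_le_nhds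
    refine ge_of_tendsto ht ?_
    filter_upwards [self_mem_nhdsWithin] with s hs using hy s hs
  have h1 : q * q * q ≤ 0 := by
    refine lim _ fun s hs => ?_
    have := smul_le_smul_of_nonneg_left (key s) (inv_nonneg.2 hs.le)
    rw [smul_smul, smul_smul, inv_mul_cancel₀ hs.ne', one_smul] at this
    rw [smul_smul]
    convert this using 2
    field_simp
  have h2 : -(q * q * q) ≤ 0 := by
    refine lim _ fun s hs => ?_
    have := smul_le_smul_of_nonneg_left (key (-s)) (inv_nonneg.2 hs.le)
    rw [smul_smul, smul_smul, mul_neg, inv_mul_cancel₀ hs.ne', neg_smul, one_smul] at this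
    rw [smul_smul]
    convert this using 2
    field_simp
  have h3 : q * q * q = 0 := le_antisymm h1 (by simpa using h2)
  have h4 : q * q = 0 := by
    have : star (q * q) * (q * q) = 0 := by
      rw [star_mul, hqs, ← mul_assoc, h3, zero_mul]
    exact (CStarRing.star_mul_self_eq_zero_iff _).1 this
  have h5 : q = 0 := by
    have : star q * q = 0 := by rw [hqs, h4]
    exact (CStarRing.star_mul_self_eq_zero_iff _).1 this
  rw [eq_neg_iff_add_eq_zero, add_comm, ← hq]; exact h5

theorem star_pres {u z : C} (hu : S.U u) (hz : z ∈ S.A) :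
    star u * S.E (u * z) = star (star u * S.E (u * star z)) := by
  have hz' : star z ∈ S.A := star_mem hz
  have h1 := skew_pres hu (sub_mem hz hz') (by simp)
  have h2 := skew_pres hu (z := Complex.I • (z + star z)) (SMulMemClass.smul_mem _ (add_mem hz hz')) (by
    simp [star_smul, add_comm])
  simp only [mul_sub, map_sub, star_sub, mul_add, map_add, mul_smul_comm, map_smul,
    star_smul, star_add] at h1 h2
  set X := star u * S.E (u * z)
  set Y := star u * S.E (u * star z)
  have h2' : Complex.I • (star X + star Y) = Complex.I • (X + Y) := by
    have := congrArg Neg.neg h2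
    simpa [smul_add, add_comm] using this
  have h3 := smul_right_injective C Complex.I_ne_zero h2'
  have h5 : (2 : ℂ) • X = (2 : ℂ) • star Y := by
    rw [two_smul, two_smul]
    have e : X + X = (X + Y) + (X - Y) := by abel
    rw [e, ← h3]
    have : X - Y = -(star X - star Y) := by rw [h1]; abel
    rw [this]; abel
  exact smul_right_injective C (two_ne_zero) h5

theorem E_star {z : C} (hz : z ∈ S.A) : S.E (star z) = star (S.E z) := by
  have := star_pres U.one (star_mem hz)
  simpa using this

theorem swap {u n : C} (hu : S.U u) (hn : n ∈ S.A) :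
    star u * S.E (u * n) = S.E (n * star u) * u := by
  rw [star_pres hu hn, star_mul, star_star, ← E_star (hu.mulA (star_mem hn))]
  simp

theorem conj {u v m : C} (hu : S.U u) (hv : S.U v) (hm : m ∈ S.A) :
    S.E (u * v * star u * m) = u * v * star u * S.E (m * star v) * v := by
  have hm' := hu.star.mulA hm
  have h1 := swap (hu.mul hv) hm'
  have h2 := swap hu (hv.star.Amul hm')
  have e : u * (star u * m * star v) = m * star v := by
    rw [← mul_assoc, ← mul_assoc, hu.r, one_mul]
  rw [e] at h2
  rw [star_mul, ← mul_assoc _ (star v), ← mul_assoc _ u, ← h2] at h1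
  calc S.E (u * v * star u * m) = u * v * (star v * star u * S.E (u * v * (star u * m))) := by
        rw [mul_assoc (u * v) (star u), ← star_mul, ← mul_assoc (u * v) (star (u * v)),
          (hu.mul hv).r, one_mul]
    _ = _ := by rw [h1]; simp only [mul_assoc]

theorem exp_sub_one_mem {x : C} (hx : x ∈ S.B) : NormedSpace.exp x - 1 ∈ S.B := by
  have h := NormedSpace.exp_series_hasSum_exp' (𝕂 := ℂ) x
  have h' := (hasSum_nat_add_iff' 1).2 h
  simp only [Finset.range_one, Finset.sum_singleton, Nat.factorial_zero, Nat.cast_one, inv_one,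
    pow_zero, one_smul] at h'
  refine S.hBcl.mem_of_tendsto h' (Filter.Eventually.of_forall fun s => ?_)
  refine sum_mem fun i _ => SMulMemClass.smul_mem _ ?_
  clear * - hx
  induction i with
  | zero => simpa using hx
  | succ n ih => rw [pow_succ]; exact mul_mem ih hx

theorem expU {h : C} (hh : h ∈ S.B) (hs : star h = h) (t : ℝ) :
    S.U (NormedSpace.exp (t • (Complex.I • h))) := by
  have hsa : IsSelfAdjoint (t • h) := by
    rw [IsSelfAdjoint, star_smul, hs, star_trivial]
  have e : ((selfAdjoint.expUnitary ⟨t • h, hsa⟩ : unitary C) : C)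
      = NormedSpace.exp (t • (Complex.I • h)) := by
    rw [selfAdjoint.expUnitary_coe, smul_comm]
  have hm := (selfAdjoint.expUnitary ⟨t • h, hsa⟩).2
  rw [e] at hm
  obtain ⟨h1, h2⟩ := Unitary.mem_iff.1 hm
  refine ⟨h1, h2, exp_sub_one_mem ?_⟩
  rw [← Complex.coe_smul]
  exact SMulMemClass.smul_mem _ (SMulMemClass.smul_mem _ hh)

theorem exp_deriv (x : C) : HasDerivAt (fun t : ℝ => NormedSpace.exp (t • x)) x 0 := by
  have := hasDerivAt_exp_smul_const (𝕂 := ℝ) x (0 : ℝ)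
  simpa using this

theorem star_exp_deriv {h : C} (hs : star h = h) :
    HasDerivAt (fun t : ℝ => star (NormedSpace.exp (t • (Complex.I • h)))) (-(Complex.I • h)) 0 := by
  have := (exp_deriv (Complex.I • h)).star
  simpa [star_smul, hs] using this

theorem J_sa {u h m : C} (hu : S.U u) (hh : h ∈ S.B) (hs : star h = h) (hm : m ∈ S.A) :
    S.E (u * h * star u * m) + S.E (m * h) = u * h * star u * S.E m + S.E m * h := by
  set x := Complex.I • h with hx
  have d1 := exp_deriv x
  have d2 := star_exp_deriv hs
  rw [← hx] at d2
  have dE : ∀ {f : ℝ → C} {f' : C}, HasDerivAt f f' 0 → HasDerivAt (fun t => S.E (f t)) (S.E f') 0 :=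
    fun hf => (S.E.restrictScalars ℝ).hasFDerivAt.comp_hasDerivAt (0 : ℝ) hf
  have dl := dE (((d1.const_mul u).mul_const (star u)).mul_const m)
  have dr := (((d1.const_mul u).mul_const (star u)).mul (dE (d2.const_mul m))).mul d1
  have heq : (fun t : ℝ => S.E (u * NormedSpace.exp (t • x) * star u * m)) =
      fun t : ℝ => u * NormedSpace.exp (t • x) * star u
        * S.E (m * star (NormedSpace.exp (t • x))) * NormedSpace.exp (t • x) := by
    funext t
    exact conj hu (expU hh hs t) hm
  rw [heq] at dl
  have := dl.unique dr
  simp only [zero_smul, NormedSpace.exp_zero, star_one, mul_one, hu.r, one_mul, hx, mul_neg,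
    mul_smul_comm, smul_mul_assoc, Pi.mul_apply, map_neg, map_smul, ← smul_neg, ← smul_add] at this
  have h3 := smul_right_injective C Complex.I_ne_zero this
  rw [h3]; abel

theorem sa_ind {P : C → Prop} (hsa : ∀ h ∈ S.B, star h = h → P h)
    (hadd : ∀ x y, P x → P y → P (x + y)) (hI : ∀ (c : ℂ) x, P x → P (c • x)) :
    ∀ b ∈ S.B, P b := by
  intro b hb
  have hb' : star b ∈ S.B := star_mem hb
  have e : b = (1 / 2 : ℂ) • (b + star b) + (-Complex.I / 2) • (Complex.I • (b - star b)) := by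
    rw [smul_smul]
    have : -Complex.I / 2 * Complex.I = 1 / 2 := by
      rw [div_mul_eq_mul_div, neg_mul, Complex.I_mul_I, neg_neg]
    rw [this, ← smul_add]
    have : b + star b + (b - star b) = (2 : ℂ) • b := by rw [two_smul]; abel
    rw [this, smul_smul]; norm_num
  rw [e]
  refine hadd _ _ (hI _ _ (hsa _ (add_mem hb hb') ?_)) (hI _ _ (hsa _ ?_ ?_))
  · simp [add_comm]
  · exact SMulMemClass.smul_mem _ (sub_mem hb hb')
  · simp [star_smul, ← smul_neg]

theorem J_all {u m : C} (hu : S.U u) (hm : m ∈ S.A) : ∀ b ∈ S.B,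
    S.E (u * b * star u * m) + S.E (m * b) = u * b * star u * S.E m + S.E m * b := by
  refine sa_ind (fun h hh hs => J_sa hu hh hs hm) ?_ ?_
  · intro x y h1 h2
    simp only [mul_add, add_mul, map_add]
    calc _ = (S.E (u * x * star u * m) + S.E (m * x)) + (S.E (u * y * star u * m) + S.E (m * y)) := by
          abel
      _ = _ := by rw [h1, h2]; abel
  · intro c x h1
    simp only [mul_smul_comm, smul_mul_assoc, map_smul, ← smul_add, h1]

theorem J_one {b m : C} (hb : b ∈ S.B) (hm : m ∈ S.A) :
    S.E (b * m) + S.E (m * b) = b * S.E m + S.E m * b := by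
  simpa using J_all U.one hm b hb

/-- the defect of left modularity -/
noncomputable def D (S : TomSetup C) (m : C) : C →L[ℂ] C :=
  S.E ∘L (ContinuousLinearMap.mul ℂ C).flip m - (ContinuousLinearMap.mul ℂ C).flip (S.E m)

theorem D_apply (m b : C) : S.D m b = S.E (b * m) - b * S.E m := by simp [D]

theorem D_mem {m b : C} (hm : m ∈ S.A) (hb : b ∈ S.B) : S.D m b ∈ S.B := by
  rw [D_apply]
  exact sub_mem (S.hEB _ (mul_mem (S.hBA _ hb) hm)) (mul_mem hb (S.hEB _ hm))

theorem D_conj {u m b : C} (hu : S.U u) (hm : m ∈ S.A) (hb : b ∈ S.B) :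
    S.D m (u * b * star u) = S.D m b := by
  rw [D_apply, D_apply]
  have h1 := J_all hu hm b hb
  have h2 := J_one hb hm
  rw [← eq_sub_iff_add_eq] at h1 h2
  rw [h1, h2]; abel

theorem D_tr_u {u m b : C} (hu : S.U u) (hm : m ∈ S.A) (hb : b ∈ S.B) :
    S.D m (u * b) = S.D m (b * u) := by
  have := D_conj hu hm (hu.Bmul hb)
  rw [← this]; congr 1
  rw [mul_assoc, mul_assoc, hu.r, mul_one]

theorem D_tr {m b c : C} (hm : m ∈ S.A) (hc : c ∈ S.B) (hb : b ∈ S.B) :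
    S.D m (c * b) = S.D m (b * c) := by
  refine sa_ind (S := S) (P := fun c => S.D m (c * b) = S.D m (b * c)) ?_ ?_ ?_ c hc
  · intro h hh hs
    have d1 := exp_deriv (Complex.I • h)
    have dE : ∀ {f : ℝ → C} {f' : C}, HasDerivAt f f' 0 →
        HasDerivAt (fun t => S.D m (f t)) (S.D m f') 0 :=
      fun hf => ((S.D m).restrictScalars ℝ).hasFDerivAt.comp_hasDerivAt (0 : ℝ) hf
    have dl := dE (d1.mul_const b)
    have dr := dE (d1.const_mul b)
    have heq : (fun t : ℝ => S.D m (NormedSpace.exp (t • (Complex.I • h)) * b)) =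
      fun t : ℝ => S.D m (b * NormedSpace.exp (t • (Complex.I • h))) := by
      funext t
      exact D_tr_u (expU hh hs t) hm hb
    rw [heq] at dl
    have := dl.unique dr
    simp only [mul_smul_comm, smul_mul_assoc, map_smul] at this
    exact smul_right_injective C Complex.I_ne_zero this
  · intro x y h1 h2
    simp only [add_mul, mul_add, map_add, h1, h2]
  · intro k x h1
    simp only [mul_smul_comm, smul_mul_assoc, map_smul, h1]

theorem E_sandwich {m b : C} (hm : m ∈ S.A) (hb : b ∈ S.B) :
    S.E (b * m * b) = b * S.E m * b := by
  have hbA := S.hBA _ hb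
  have h1 := J_one hb hm
  have h2 := J_one hb (mul_mem hbA hm)
  have h3 := J_one hb (mul_mem hm hbA)
  have h4 := J_one (mul_mem hb hb) hm
  simp only [mul_assoc] at *
  have h5 : (2 : ℂ) • S.E (b * (m * b)) = (2 : ℂ) • (b * (S.E m * b)) := by
    rw [two_smul, two_smul]
    have e1 : S.E (b * (m * b)) + S.E (b * (m * b)) =
      (S.E (b * (b * m)) + S.E (b * (m * b))) + (S.E (b * (m * b)) + S.E (m * (b * b)))
        - (S.E (b * (b * m)) + S.E (m * (b * b))) := by abel
    rw [e1, h2, h3, h4]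
    have e2 : b * S.E (b * m) + S.E (b * m) * b + (b * S.E (m * b) + S.E (m * b) * b)
      = b * (S.E (b * m) + S.E (m * b)) + (S.E (b * m) + S.E (m * b)) * b := by noncomm_ring
    rw [e2, h1]; noncomm_ring
  exact smul_right_injective C (two_ne_zero) h5

theorem D_sq {m b : C} (hm : m ∈ S.A) (hb : b ∈ S.B) :
    S.D m (b * b) = b * S.D m b + S.D m b * b := by
  simp only [D_apply]
  have h2 := J_one hb (mul_mem (S.hBA _ hb) hm)
  rw [E_sandwich hm hb, ← eq_sub_iff_add_eq] at h2
  rw [mul_assoc, h2]; noncomm_ring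

theorem D_mul {m b c : C} (hm : m ∈ S.A) (hb : b ∈ S.B) (hc : c ∈ S.B) :
    (2 : ℂ) • S.D m (b * c) = b * S.D m c + S.D m c * b + (c * S.D m b + S.D m b * c) := by
  have h := D_sq hm (add_mem hb hc)
  have h1 := D_sq hm hb
  have h2 := D_sq hm hc
  have h3 := D_tr hm hb hc
  have e : (b + c) * (b + c) = b * b + b * c + c * b + c * c := by noncomm_ring
  rw [e, map_add, map_add, map_add, h1, h2, ← h3, map_add] at h
  rw [two_smul]
  have : S.D m (b * c) + S.D m (b * c) = (b * S.D m b + S.D m b * b + S.D m (b * c)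
    + S.D m (b * c) + (c * S.D m c + S.D m c * c)) - (b * S.D m b + S.D m b * b)
    - (c * S.D m c + S.D m c * c) := by abel
  rw [this, h]; noncomm_ring

theorem D_anti {m a c : C} (hm : m ∈ S.A) (ha : a ∈ S.B) (hc : c ∈ S.B) :
    (a * c - c * a) * S.D m a + S.D m a * (a * c - c * a) = 0 := by
  have h1 := D_mul hm ha (mul_mem ha hc)
  have h2 := D_mul hm ha (mul_mem hc ha)
  have h3 : S.D m (a * (a * c)) = S.D m (a * (c * a)) := by
    rw [D_tr hm ha (mul_mem ha hc), mul_assoc]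
  rw [h3, h2, D_tr hm hc ha] at h1
  have h4 := add_left_cancel h1
  have : (a * c - c * a) * S.D m a + S.D m a * (a * c - c * a) =
    (a * c * S.D m a + S.D m a * (a * c)) - (c * a * S.D m a + S.D m a * (c * a)) := by
    noncomm_ring
  rw [this, h4, sub_self]

theorem D_comm {m a : C} (hm : m ∈ S.A) (ha : a ∈ S.B) : a * S.D m a = S.D m a * a := by
  have hx := D_mem hm ha
  have hanti := fun c hc => D_anti (c := c) hm ha hc
  set x := S.D m a
  clear_value x
  -- first product relation
  have h1 : ∀ c ∈ S.B, (a * c - c * a) * (a * x - x * a) = 0 := by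
    intro c hc
    have e1 := hanti c hc
    have e2 := hanti (c * a) (mul_mem hc ha)
    have : (a * c - c * a) * (a * x - x * a) =
      ((a * (c * a) - c * a * a) * x + x * (a * (c * a) - c * a * a))
      - ((a * c - c * a) * x + x * (a * c - c * a)) * a := by noncomm_ring
    rw [this, e1, e2]; simp
  set q := a * x - x * a with hq
  have hqB : q ∈ S.B := sub_mem (mul_mem ha hx) (mul_mem hx ha)
  have h2 : q * star q * q = 0 := by
    have e1 := h1 (x * star q) (mul_mem hx (star_mem hqB))
    have e2 := h1 (star q) (star_mem hqB)
    have : q * star q * q = (a * (x * star q) - x * star q * a) * q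
        - x * ((a * star q - star q * a) * q) := by
      nth_rewrite 1 [hq]; noncomm_ring
    rw [this, e1, e2]; simp
  have h3 : star q * q = 0 := by
    have : star (star q * q) * (star q * q) = 0 := by
      rw [star_mul, star_star, mul_assoc, ← mul_assoc q, h2, mul_zero]
    exact (CStarRing.star_mul_self_eq_zero_iff _).1 this
  exact sub_eq_zero.1 ((CStarRing.star_mul_self_eq_zero_iff _).1 h3)

theorem D_one (m : C) : S.D m 1 = 0 := by simp [D_apply]

theorem D_u_sq {m u : C} (hm : m ∈ S.A) (hu : S.U u) :
    ‖S.D m (u * u)‖ = 2 * ‖S.D m u‖ := by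
  have h1 := D_sq hm hu.m
  have h2 := D_comm hm hu.m
  have h3 : S.D m (u - 1) = S.D m u := by rw [map_sub, D_one, sub_zero]
  rw [h3] at h1 h2
  have e : u * u = (u - 1) * (u - 1) + (u - 1) + u := by noncomm_ring
  have h4 : S.D m (u * u) = u * ((2 : ℂ) • S.D m u) := by
    rw [e, map_add, map_add, h1, h3, ← h2, two_smul]; noncomm_ring
  rw [h4, hu.norm_mul, norm_smul]; simp

theorem D_u {m u : C} (hm : m ∈ S.A) (hu : S.U u) : S.D m u = 0 := by
  have hb : ∀ u, S.U u → ‖S.D m u‖ ≤ ‖S.D m‖ := by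
    intro u hu
    have h := (S.D m).le_opNorm u
    have h1 : ‖u‖ ≤ 1 := by
      have := hu.norm_mul 1
      rw [mul_one] at this
      rw [this]
      rcases subsingleton_or_nontrivial C with h | h
      · rw [Subsingleton.elim (1 : C) 0]; simp
      · simp
    exact h.trans (mul_le_of_le_one_right (norm_nonneg _) h1)
  have hi : ∀ n : ℕ, ∀ u, S.U u → 2 ^ n * ‖S.D m u‖ ≤ ‖S.D m‖ := by
    intro n
    induction n with
    | zero => intro u hu; simpa using hb u hu
    | succ n ih =>
      intro u hu
      have := ih _ (hu.mul hu)
      rw [D_u_sq hm hu] at this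
      rw [pow_succ]; linarith
  by_contra h0
  have hpos : 0 < ‖S.D m u‖ := norm_pos_iff.2 h0
  obtain ⟨n, hn⟩ := pow_unbounded_of_one_lt (‖S.D m‖ / ‖S.D m u‖) (one_lt_two)
  rw [div_lt_iff₀ hpos] at hn
  linarith [hi n u hu]

theorem D_zero {m b : C} (hm : m ∈ S.A) (hb : b ∈ S.B) : S.D m b = 0 := by
  refine sa_ind (S := S) (P := fun b => S.D m b = 0) ?_ ?_ ?_ b hb
  · intro h hh hs
    have d1 := exp_deriv (Complex.I • h)
    have dl := ((S.D m).restrictScalars ℝ).hasFDerivAt.comp_hasDerivAt (0 : ℝ) d1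
    have heq : (((S.D m).restrictScalars ℝ) ∘ fun t : ℝ => NormedSpace.exp (t • (Complex.I • h))) =
      fun t : ℝ => (0 : C) := by
      funext t
      exact D_u hm (expU hh hs t)
    rw [heq] at dl
    have := dl.unique (hasDerivAt_const _ _)
    simpa using this
  · intro x y h1 h2
    simp only [map_add, h1, h2, add_zero]
  · intro k x h1
    simp only [map_smul, h1, smul_zero]

theorem E_left {m b : C} (hm : m ∈ S.A) (hb : b ∈ S.B) : S.E (b * m) = b * S.E m := by
  have := D_zero hm hb
  rwa [D_apply, sub_eq_zero] at this

theorem E_right {m b : C} (hm : m ∈ S.A) (hb : b ∈ S.B) : S.E (m * b) = S.E m * b := by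
  have := J_one hb hm
  rw [E_left hm hb] at this
  exact add_left_cancel this

end TomSetup

theorem tom_ortho {C : Type*} [CStarAlgebra C] {x z d₀ : C} (hz : d₀ * z = 0)
    (hc : ∀ s : ℝ, ‖star d₀ * d₀ * x + s • x‖ ≤ ‖star d₀ * d₀ * x + s • z‖) : d₀ * x = 0 := by
  let _ := CStarAlgebra.spectralOrder C
  have _ := CStarAlgebra.spectralOrderedRing C
  set d := star d₀ * d₀ with hd
  have hds : star d = d := by simp [hd]
  have hdz : d * z = 0 := by rw [hd, mul_assoc, hz, mul_zero]
  have hzd : star z * d = 0 := by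
    have := congrArg star hdz
    simpa [hds] using this
  set y := d * x with hy
  have hdn : d * d ≤ ‖d‖ • d := by
    have h1 : d₀ * star d₀ ≤ algebraMap ℝ C (‖d‖) := by
      have := CStarAlgebra.mul_star_le_algebraMap_norm_sq (a := d₀)
      rwa [sq, ← CStarRing.norm_star_mul_self] at this
    have h2 := star_left_conjugate_le_conjugate h1 d₀
    rw [Algebra.algebraMap_eq_smul_one, mul_smul_comm, mul_one, smul_mul_assoc] at h2
    simpa [hd, mul_assoc] using h2
  have hyy : star y * y ≤ ‖d‖ • (star x * d * x) := by
    have := star_left_conjugate_le_conjugate hdn x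
    have e : star y * y = star x * (d * d) * x := by
      rw [hy, star_mul, hds]; simp only [mul_assoc]
    rwa [← e, mul_smul_comm, smul_mul_assoc] at this
  have main : ∀ s : ℝ, 0 < s → 2 * ‖y‖ ^ 2 ≤ s * (‖d‖ * ‖z‖ ^ 2) := by
    intro s hs
    have h1 : ‖y + s • z‖ ^ 2 ≤ ‖y‖ ^ 2 + s ^ 2 * ‖z‖ ^ 2 := by
      have : star (y + s • z) * (y + s • z) = star y * y + s ^ 2 • (star z * z) := by
        have e1 : star y * z = 0 := by rw [hy, star_mul, hds, mul_assoc, hdz, mul_zero]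
        have e2 : star z * y = 0 := by rw [hy, ← mul_assoc, hzd, zero_mul]
        simp only [star_add, star_smul, star_trivial, add_mul, mul_add, smul_mul_assoc,
          mul_smul_comm, e1, e2, smul_zero, smul_smul, sq, add_zero, zero_add]
      rw [sq, ← CStarRing.norm_star_mul_self, this]
      refine (norm_add_le _ _).trans ?_
      rw [norm_smul, CStarRing.norm_star_mul_self, CStarRing.norm_star_mul_self,
        Real.norm_of_nonneg (sq_nonneg s), sq ‖y‖, sq ‖z‖]
    have h2 : ‖y + s • x‖ ^ 2 ≤ ‖y‖ ^ 2 + s ^ 2 * ‖z‖ ^ 2 :=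
      (pow_le_pow_left₀ (norm_nonneg _) (hc s) 2).trans h1
    have h3 : (‖d‖ + 2 * s) • (star y * y) ≤ ‖d‖ • (star (y + s • x) * (y + s • x)) := by
      have e : star (y + s • x) * (y + s • x) =
          star y * y + (2 * s) • (star x * d * x) + s ^ 2 • (star x * x) := by
        have e1 : star y * x = star x * d * x := by rw [hy, star_mul, hds]
        have e2 : star x * y = star x * d * x := by rw [hy, ← mul_assoc]
        simp only [star_add, star_smul, star_trivial, add_mul, mul_add, smul_mul_assoc,
          mul_smul_comm, e1, e2, smul_add, smul_smul, sq, two_mul, add_smul]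
        abel
      rw [e, add_smul, smul_add, smul_add]
      have e3 : 0 ≤ ‖d‖ • s ^ 2 • (star x * x) :=
        smul_nonneg (norm_nonneg _) (smul_nonneg (sq_nonneg s) (star_mul_self_nonneg x))
      refine le_trans ?_ (le_add_of_nonneg_right e3)
      rw [smul_comm ‖d‖ (2 * s)]
      gcongr
    have h4 := CStarAlgebra.norm_le_norm_of_nonneg_of_le
      (smul_nonneg (by positivity) (star_mul_self_nonneg y)) h3
    rw [norm_smul, norm_smul, CStarRing.norm_star_mul_self (x := y),
      CStarRing.norm_star_mul_self (x := y + s • x),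
      Real.norm_of_nonneg (by positivity), Real.norm_of_nonneg (norm_nonneg d)] at h4
    have h5 : ‖d‖ * (‖y + s • x‖ * ‖y + s • x‖) ≤ ‖d‖ * (‖y‖ ^ 2 + s ^ 2 * ‖z‖ ^ 2) := by
      rw [← sq]; gcongr
    have h6 : s * (2 * ‖y‖ ^ 2) ≤ s * (s * (‖d‖ * ‖z‖ ^ 2)) := by nlinarith
    exact le_of_mul_le_mul_left h6 hs
  have hy0 : ‖y‖ ^ 2 ≤ 0 := by
    by_contra! hpos
    set K := ‖d‖ * ‖z‖ ^ 2 with hK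
    have hK0 : 0 ≤ K := by positivity
    have := main (‖y‖ ^ 2 / (K + 1)) (by positivity)
    rw [div_mul_eq_mul_div, le_div_iff₀ (by positivity)] at this
    nlinarith
  have hy1 : y = 0 := by
    have : ‖y‖ = 0 := by nlinarith [norm_nonneg y]
    exact norm_eq_zero.1 this
  have : star (d₀ * x) * (d₀ * x) = 0 := by
    have e : star (d₀ * x) * (d₀ * x) = star x * y := by
      rw [hy, hd, star_mul]; simp only [mul_assoc]
    rw [e, hy1, mul_zero]
  exact (CStarRing.star_mul_self_eq_zero_iff _).1 this

/-- contractive projection onto a closed star subalgebra -/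
structure TomH {A : Type*} [NonUnitalCStarAlgebra A]
    (B : NonUnitalStarSubalgebra ℂ A) (E : A →ₗ[ℂ] A) : Prop where
  cl : IsClosed (B : Set A)
  mem : ∀ a : A, E a ∈ B
  id : ∀ b ∈ B, E b = b
  norm : ∀ a : A, ‖E a‖ ≤ ‖a‖

namespace TomH

variable {A : Type*} [NonUnitalCStarAlgebra A]

/-- conjugated map -/
def conjMap (E : A →ₗ[ℂ] A) : A →ₗ[ℂ] A where
  toFun a := star (E (star a))
  map_add' a b := by simp
  map_smul' c a := by simp [star_smul]

variable {B : NonUnitalStarSubalgebra ℂ A} {E : A →ₗ[ℂ] A}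

theorem conj (h : TomH B E) : TomH B (conjMap E) where
  cl := h.cl
  mem a := star_mem (h.mem _)
  id b hb := by simp [conjMap, h.id _ (star_mem hb)]
  norm a := by simpa [conjMap] using h.norm (star a)

theorem kill (h : TomH B E) {d₀ : Unitization ℂ A} {z : A}
    (hd : ∀ x ∈ B, ∃ y ∈ B, star d₀ * d₀ * (x : Unitization ℂ A) = (y : Unitization ℂ A))
    (hz : d₀ * (z : Unitization ℂ A) = 0) : d₀ * (E z : Unitization ℂ A) = 0 := by
  refine tom_ortho hz fun s => ?_
  obtain ⟨y, hy, e⟩ := hd _ (h.mem z)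
  rw [e]
  have := h.norm (y + s • z)
  rw [map_add, h.id y hy, E.map_smul_of_tower] at this
  simpa [← Unitization.inr_smul, ← Unitization.inr_add, Unitization.norm_inr] using this

theorem kill_mul (h : TomH B E) {b z : A} (hb : b ∈ B) (hz : b * z = 0) : b * E z = 0 := by
  have := h.kill (d₀ := (b : Unitization ℂ A)) (z := z)
    (fun x hx => ⟨star b * b * x, mul_mem (mul_mem (star_mem hb) hb) hx, by simp⟩)
    (by rw [← Unitization.inr_mul, hz, Unitization.inr_zero])
  rw [← Unitization.inr_mul] at this
  exact Unitization.inr_injective (R := ℂ) (by simpa using this)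

theorem kill_mul' (h : TomH B E) {b z : A} (hb : b ∈ B) (hz : z * b = 0) : E z * b = 0 := by
  have := h.conj.kill_mul (b := star b) (z := star z) (star_mem hb)
    (by rw [← star_mul, hz, star_zero])
  simpa [conjMap, ← star_mul] using this

theorem fix (h : TomH B E) {g z : A} (hg : g ∈ B) (hz : g * z = z) : g * E z = E z := by
  have := h.kill (d₀ := 1 - (g : Unitization ℂ A)) (z := z)
    (fun x hx => ⟨x - g * x - star g * (x - g * x), ?_, ?_⟩) ?_
  · rw [sub_mul, one_mul, ← Unitization.inr_mul, sub_eq_zero] at this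
    exact (Unitization.inr_injective (R := ℂ) this).symm
  · have : x - g * x ∈ B := sub_mem hx (mul_mem hg hx)
    exact sub_mem this (mul_mem (star_mem hg) this)
  · simp only [Unitization.inr_sub, Unitization.inr_mul, Unitization.inr_star, star_sub, star_one]
    noncomm_ring
  · rw [sub_mul, one_mul, ← Unitization.inr_mul, hz, sub_self]

theorem fix' (h : TomH B E) {g z : A} (hg : g ∈ B) (hz : z * g = z) : E z * g = E z := by
  have := h.conj.fix (g := star g) (z := star z) (star_mem hg) (by rw [← star_mul, hz])
  simpa [conjMap, ← star_mul] using this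

/-- elements on which `g` acts as a unit -/
def loc (g : A) (hg : star g = g) : NonUnitalStarSubalgebra ℂ A where
  carrier := {a | g * a = a ∧ a * g = a}
  add_mem' := by
    rintro a b ⟨h1, h2⟩ ⟨h3, h4⟩
    exact ⟨by rw [mul_add, h1, h3], by rw [add_mul, h2, h4]⟩
  zero_mem' := by simp
  mul_mem' := by
    rintro a b ⟨h1, h2⟩ ⟨h3, h4⟩
    exact ⟨by rw [← mul_assoc, h1], by rw [mul_assoc, h4]⟩
  smul_mem' := by
    rintro c a ⟨h1, h2⟩
    exact ⟨by rw [mul_smul_comm, h1], by rw [smul_mul_assoc, h2]⟩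
  star_mem' := by
    rintro a ⟨h1, h2⟩
    constructor
    · have := congrArg star h2; simpa [hg] using this
    · have := congrArg star h1; simpa [hg] using this

theorem mem_loc {g a : A} {hg : star g = g} : a ∈ loc g hg ↔ g * a = a ∧ a * g = a := Iff.rfl

theorem isClosed_loc (g : A) (hg : star g = g) : IsClosed (loc g hg : Set A) := by
  have : (loc g hg : Set A) = {a | g * a = a} ∩ {a | a * g = a} := rfl
  rw [this]
  exact (isClosed_eq (by fun_prop) (by fun_prop)).inter (isClosed_eq (by fun_prop) (by fun_prop))

noncomputable def setup (h : TomH B E) (g : A) (hgB : g ∈ B) (hg : star g = g) (hgn : ‖g‖ ≤ 1) :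
    TomSetup (Unitization ℂ A) where
  A := (loc g hg).map (Unitization.inrNonUnitalStarAlgHom ℂ A)
  B := (loc g hg ⊓ B).map (Unitization.inrNonUnitalStarAlgHom ℂ A)
  E := ⟨Unitization.inrHom ℂ ℂ A ∘ₗ E ∘ₗ Unitization.sndHom ℂ ℂ A, by
    have hE : Continuous E := (E.mkContinuous 1 (fun a => by simpa using h.norm a)).continuous
    exact (Unitization.isometry_inr (𝕜 := ℂ) (A := A)).continuous.comp
      (hE.comp Unitization.continuous_snd)⟩
  G := g
  hBA := by
    rintro _ ⟨b, hb, rfl⟩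
    exact ⟨b, hb.1, rfl⟩
  hBcl := by
    have := (Unitization.isometry_inr (𝕜 := ℂ) (A := A)).isClosedEmbedding.isClosedMap _
      ((isClosed_loc g hg).inter h.cl)
    exact this
  hEB := by
    rintro _ ⟨a, ha, rfl⟩
    exact ⟨E a, ⟨⟨h.fix hgB ha.1, h.fix' hgB ha.2⟩, h.mem a⟩, rfl⟩
  hid := by
    rintro _ ⟨b, hb, rfl⟩
    exact congrArg Unitization.inr (h.id b hb.2)
  hG := by rw [← Unitization.inr_star, hg]
  hGn := by rwa [Unitization.norm_inr]
  hGA := by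
    rintro _ ⟨a, ha, rfl⟩
    exact (Unitization.inr_mul ℂ g a).symm.trans (congrArg Unitization.inr ha.1)
  hcon := by
    rintro _ ⟨a, ha, rfl⟩
    have := h.norm (g + a)
    rw [map_add, h.id g hgB] at this
    change ‖(g : Unitization ℂ A) + (E a : Unitization ℂ A)‖
      ≤ ‖(g : Unitization ℂ A) + (a : Unitization ℂ A)‖
    simpa [← Unitization.inr_add, Unitization.norm_inr] using this

theorem local_bimod (h : TomH B E) {g m b c : A} (hgB : g ∈ B) (hg : star g = g) (hgn : ‖g‖ ≤ 1)
    (hm : m ∈ loc g hg) (hb : b ∈ loc g hg) (hbB : b ∈ B) (hc : c ∈ loc g hg) (hcB : c ∈ B) :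
    E (b * m * c) = b * E m * c := by
  let S := h.setup g hgB hg hgn
  have e1 : E (b * m) = b * E m := by
    have := TomSetup.E_left (S := S) (m := (m : Unitization ℂ A)) (b := (b : Unitization ℂ A))
      (show _ ∈ NonUnitalStarSubalgebra.map _ _ from ⟨m, hm, rfl⟩)
      (show _ ∈ NonUnitalStarSubalgebra.map _ _ from ⟨b, ⟨hb, hbB⟩, rfl⟩)
    rw [← Unitization.inr_mul] at this
    refine Unitization.inr_injective (R := ℂ) ?_
    rw [Unitization.inr_mul]
    exact this
  have e2 : E (b * m * c) = E (b * m) * c := by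
    have := TomSetup.E_right (S := S) (m := ((b * m : A) : Unitization ℂ A))
      (b := (c : Unitization ℂ A))
      (show _ ∈ NonUnitalStarSubalgebra.map _ _ from ⟨b * m, mul_mem hb hm, rfl⟩)
      (show _ ∈ NonUnitalStarSubalgebra.map _ _ from ⟨c, ⟨hc, hcB⟩, rfl⟩)
    rw [← Unitization.inr_mul] at this
    refine Unitization.inr_injective (R := ℂ) ?_
    rw [Unitization.inr_mul ℂ (E (b * m))]
    exact this
  rw [e2, e1]

theorem mid_bimod (h : TomH B E) {g e a b c : A} (hgB : g ∈ B) (hg : star g = g) (hgn : ‖g‖ ≤ 1)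
    (he : e ∈ loc g hg) (heB : e ∈ B)
    (hb : b ∈ loc g hg) (hbB : b ∈ B) (hc : c ∈ loc g hg) (hcB : c ∈ B)
    (hbe : b * e = b) (hec : e * c = c) :
    E (b * a * c) = b * E a * c := by
  have hm : e * a * e ∈ loc g hg :=
    ⟨by rw [← mul_assoc, ← mul_assoc, he.1], by rw [mul_assoc, he.2]⟩
  have h1 := h.local_bimod hgB hg hgn hm hb hbB hc hcB
  have e1 : b * (e * a * e) * c = b * a * c := by
    rw [← mul_assoc, ← mul_assoc, hbe, mul_assoc (b * a), hec]
  have e2 : b * E (a - e * a) = 0 :=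
    h.kill_mul hbB (by rw [mul_sub, ← mul_assoc, hbe, sub_self])
  have e3 : E (e * a - e * a * e) * c = 0 :=
    h.kill_mul' hcB (by rw [sub_mul, mul_assoc (e * a), hec, sub_self])
  rw [map_sub, mul_sub, sub_eq_zero] at e2
  rw [map_sub, sub_mul, sub_eq_zero] at e3
  rw [e1] at h1
  rw [h1, e2, mul_assoc b, mul_assoc b, e3]

/-- ramp function -/
noncomputable def ramp (δ t : ℝ) : ℝ := max 0 (min 1 ((t - δ) / δ))

theorem ramp_cont (δ : ℝ) : Continuous (ramp δ) := by unfold ramp; fun_prop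

theorem ramp_zero {δ : ℝ} (hδ : 0 < δ) {t : ℝ} (ht : t ≤ δ) : ramp δ t = 0 := by
  have : (t - δ) / δ ≤ 0 := div_nonpos_of_nonpos_of_nonneg (by linarith) hδ.le
  unfold ramp
  rw [min_eq_right (by linarith), max_eq_left this]

theorem ramp_one {δ : ℝ} (hδ : 0 < δ) {t : ℝ} (ht : 2 * δ ≤ t) : ramp δ t = 1 := by
  have : 1 ≤ (t - δ) / δ := by rw [le_div_iff₀ hδ]; linarith
  unfold ramp
  rw [min_eq_left this, max_eq_right zero_le_one]

theorem ramp_nonneg (δ t : ℝ) : 0 ≤ ramp δ t := le_max_left _ _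

theorem ramp_le (δ t : ℝ) : ramp δ t ≤ 1 := max_le zero_le_one (min_le_left _ _)

theorem ramp_mul {δ : ℝ} (hδ : 0 < δ) (t : ℝ) : ramp δ t * ramp (2 * δ) t = ramp (2 * δ) t := by
  rcases le_total t (2 * δ) with h | h
  · rw [ramp_zero (by linarith) h, mul_zero]
  · rw [ramp_one hδ h, one_mul]

/-- local unit -/
noncomputable def lu (h : A) (δ : ℝ) : A := cfcₙ (ramp δ) h

theorem lu_star (h : A) (δ : ℝ) : star (lu h δ) = lu h δ :=
  (cfcₙ_predicate (R := ℝ) (ramp δ) h : IsSelfAdjoint _)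

theorem lu_norm (h : A) (δ : ℝ) : ‖lu h δ‖ ≤ 1 :=
  norm_cfcₙ_le fun x _ => by
    rw [Real.norm_of_nonneg (ramp_nonneg _ _)]; exact ramp_le _ _

theorem lu_mul (h : A) {δ : ℝ} (hδ : 0 < δ) : lu h δ * lu h (2 * δ) = lu h (2 * δ) := by
  unfold lu
  rw [← cfcₙ_mul (ramp δ) (ramp (2 * δ)) h (ramp_cont _).continuousOn (ramp_zero hδ hδ.le)
    (ramp_cont _).continuousOn (ramp_zero (by linarith) (by linarith))]
  congr 1
  funext t
  exact ramp_mul hδ t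

theorem lu_mul' (h : A) {δ : ℝ} (hδ : 0 < δ) : lu h (2 * δ) * lu h δ = lu h (2 * δ) := by
  have := congrArg star (lu_mul h hδ)
  simpa [lu_star] using this

theorem lu_mem (hB : IsClosed (B : Set A)) {h : A} (hh : h ∈ B) (hs : IsSelfAdjoint h) (δ : ℝ) :
    lu h δ ∈ B := by
  have : IsClosed (B : Set A) := hB
  unfold lu
  exact cfcₙ_mem (𝕜' := ℂ) (ramp δ) hh

theorem lu_approx {h b : A} {δ : ℝ} (hδ : 0 < δ) (hs : ∃ w₁ w₂ w₃ : A,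
    h = b * star b + w₁ * star w₁ + w₂ * star w₂ + w₃ * star w₃) :
    ‖b - lu h δ * b‖ ^ 2 ≤ 2 * δ := by
  let _ := CStarAlgebra.spectralOrder A
  have _ := CStarAlgebra.spectralOrderedRing A
  let _ := CStarAlgebra.spectralOrder (Unitization ℂ A)
  have _ := CStarAlgebra.spectralOrderedRing (Unitization ℂ A)
  obtain ⟨w₁, w₂, w₃, hw⟩ := hs
  have hpos : 0 ≤ h := by
    rw [hw]
    exact add_nonneg (add_nonneg (add_nonneg (mul_star_self_nonneg _) (mul_star_self_nonneg _))
      (mul_star_self_nonneg _)) (mul_star_self_nonneg _)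
  have hsa : IsSelfAdjoint h := hpos.isSelfAdjoint
  have hle : (b : Unitization ℂ A) * star (b : Unitization ℂ A) ≤ (h : Unitization ℂ A) := by
    rw [hw]
    simp only [Unitization.inr_add, Unitization.inr_mul, Unitization.inr_star]
    rw [add_assoc, add_assoc]
    exact le_add_of_nonneg_right (add_nonneg (mul_star_self_nonneg _)
      (add_nonneg (mul_star_self_nonneg _) (mul_star_self_nonneg _)))
  set f := lu h δ with hf
  set p : Unitization ℂ A := 1 - (f : Unitization ℂ A) with hp
  have hps : star p = p := by rw [hp, star_sub, star_one, ← Unitization.inr_star, lu_star]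
  have h1 := star_left_conjugate_le_conjugate hle p
  rw [hps] at h1
  have h2 : p * (b * star (b : Unitization ℂ A)) * p
      = ((b - f * b : A) : Unitization ℂ A) * star ((b - f * b : A) : Unitization ℂ A) := by
    have : ((b - f * b : A) : Unitization ℂ A) = p * b := by
      rw [hp, sub_mul, one_mul, Unitization.inr_sub, Unitization.inr_mul]
    rw [this, star_mul, hps]; simp only [mul_assoc]
  have h3 : p * h * p = ((cfcₙ (fun t => (t - ramp δ t * t) - (t - ramp δ t * t) * ramp δ t) h : A) :
      Unitization ℂ A) := by
    have hc : ∀ s : Set ℝ, ContinuousOn (ramp δ) s := fun s => (ramp_cont δ).continuousOn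
    have h0 : ramp δ 0 = 0 := ramp_zero hδ hδ.le
    have c1 : Continuous fun t => ramp δ t * t := (ramp_cont δ).mul continuous_id
    have c2 : Continuous fun t => t - ramp δ t * t := continuous_id.sub c1
    have c3 : Continuous fun t => (t - ramp δ t * t) * ramp δ t := c2.mul (ramp_cont δ)
    have e0 : cfcₙ (fun t : ℝ => t) h = h := cfcₙ_id' ℝ h
    have e1 : cfcₙ (fun t => ramp δ t * t) h = f * h := by
      rw [cfcₙ_mul (ramp δ) (fun t => t) h (hc _) h0 continuous_id.continuousOn rfl, e0, hf, lu]
    have e2 : cfcₙ (fun t => t - ramp δ t * t) h = h - f * h := by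
      rw [cfcₙ_sub (fun t => t) (fun t => ramp δ t * t) h continuous_id.continuousOn rfl
        c1.continuousOn (by simp), e0, e1]
    have e3 : cfcₙ (fun t => (t - ramp δ t * t) * ramp δ t) h = (h - f * h) * f := by
      rw [cfcₙ_mul (fun t => t - ramp δ t * t) (ramp δ) h c2.continuousOn (by simp) (hc _) h0, e2,
        hf, lu]
    rw [cfcₙ_sub (fun t => t - ramp δ t * t) (fun t => (t - ramp δ t * t) * ramp δ t) h
      c2.continuousOn (by simp) c3.continuousOn (by simp), e2, e3]
    simp only [Unitization.inr_sub, Unitization.inr_mul, hp]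
    noncomm_ring
  have h4 : ‖cfcₙ (fun t => (t - ramp δ t * t) - (t - ramp δ t * t) * ramp δ t) h‖ ≤ 2 * δ := by
    refine norm_cfcₙ_le fun t ht => ?_
    have ht0 : 0 ≤ t := quasispectrum_nonneg_of_nonneg h hpos t ht
    have e : (t - ramp δ t * t) - (t - ramp δ t * t) * ramp δ t = t * (1 - ramp δ t) ^ 2 := by ring
    rw [e, Real.norm_of_nonneg (by positivity)]
    rcases le_total t (2 * δ) with h' | h'
    · have h5 := ramp_nonneg δ t
      have h6 := ramp_le δ t
      have : (1 - ramp δ t) ^ 2 ≤ 1 := by nlinarith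
      nlinarith
    · rw [ramp_one hδ h']; simp; linarith
  have h5 := CStarAlgebra.norm_le_norm_of_nonneg_of_le (by
    rw [h2]; exact mul_star_self_nonneg _) h1
  rw [h2, h3, CStarRing.norm_self_mul_star, Unitization.norm_inr, Unitization.norm_inr, ← sq] at h5
  exact h5.trans h4

theorem lu_tendsto {h b : A} (hs : ∃ w₁ w₂ w₃ : A,
    h = b * star b + w₁ * star w₁ + w₂ * star w₂ + w₃ * star w₃) :
    Filter.Tendsto (fun δ : ℝ => lu h δ * b) (nhdsWithin 0 (Set.Ioi 0)) (nhds b) := by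
  rw [tendsto_iff_norm_sub_tendsto_zero]
  have ht : Filter.Tendsto (fun δ : ℝ => Real.sqrt (2 * δ)) (nhdsWithin 0 (Set.Ioi 0))
      (nhds 0) := by
    have : Continuous (fun δ : ℝ => Real.sqrt (2 * δ)) := by fun_prop
    have := this.tendsto 0
    simp only [mul_zero, Real.sqrt_zero] at this
    exact this.mono_left nhdsWithin_le_nhds
  refine squeeze_zero' (Filter.Eventually.of_forall fun _ => norm_nonneg _) ?_ ht
  filter_upwards [self_mem_nhdsWithin] with δ hδ
  rw [norm_sub_rev]
  exact Real.le_sqrt_of_sq_le (lu_approx hδ hs)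

theorem lu_tendsto' {h b : A} (hs : ∃ w₁ w₂ w₃ : A,
    h = b * star b + w₁ * star w₁ + w₂ * star w₂ + w₃ * star w₃)
    (hs' : ∃ w₁ w₂ w₃ : A,
    h = star b * b + w₁ * star w₁ + w₂ * star w₂ + w₃ * star w₃) :
    Filter.Tendsto (fun δ : ℝ => lu h δ * b * lu h δ) (nhdsWithin 0 (Set.Ioi 0)) (nhds b) := by
  have h1 := lu_tendsto hs
  have h2 : Filter.Tendsto (fun δ : ℝ => b * lu h δ) (nhdsWithin 0 (Set.Ioi 0)) (nhds b) := by
    have := (lu_tendsto (b := star b) (by simpa using hs')).star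
    simpa [lu_star] using this
  rw [tendsto_iff_norm_sub_tendsto_zero] at *
  have h3 := h1.add h2
  rw [add_zero] at h3
  refine squeeze_zero (fun _ => norm_nonneg _) (fun δ => ?_) h3
  have e : lu h δ * b * lu h δ - b = (lu h δ * b - b) + lu h δ * (b * lu h δ - b)  := by
    rw [mul_sub, ← mul_assoc]; abel
  rw [e]
  refine (norm_add_le _ _).trans ?_
  gcongr
  exact (norm_mul_le _ _).trans (mul_le_of_le_one_left (norm_nonneg _) (lu_norm _ _))

theorem bimod (h : TomH B E) (a : A) {b c : A} (hb : b ∈ B) (hc : c ∈ B) :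
    E (b * a * c) = b * E a * c := by
  set k := b * star b + star b * b + c * star c + star c * c with hk
  have hkB : k ∈ B := add_mem (add_mem (add_mem (mul_mem hb (star_mem hb)) (mul_mem (star_mem hb) hb))
    (mul_mem hc (star_mem hc))) (mul_mem (star_mem hc) hc)
  have hks : IsSelfAdjoint k := by simp [IsSelfAdjoint, hk]
  have tb : Filter.Tendsto (fun δ : ℝ => lu k δ * b * lu k δ) (nhdsWithin 0 (Set.Ioi 0)) (nhds b) := by
    refine lu_tendsto' ⟨star b, c, star c, ?_⟩ ⟨b, c, star c, ?_⟩ <;>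
    · simp only [star_star, hk]; try abel
  have tc : Filter.Tendsto (fun δ : ℝ => lu k δ * c * lu k δ) (nhdsWithin 0 (Set.Ioi 0)) (nhds c) := by
    refine lu_tendsto' ⟨star c, b, star b, ?_⟩ ⟨c, b, star b, ?_⟩ <;>
    · simp only [star_star, hk]; try abel
  have hE : Continuous E := (E.mkContinuous 1 (fun a => by simpa using h.norm a)).continuous
  have t1 := (hE.tendsto _).comp ((tb.mul_const a).mul tc)
  have t2 := (tb.mul_const (E a)).mul tc
  refine tendsto_nhds_unique_of_eventuallyEq t1 t2 ?_
  filter_upwards [self_mem_nhdsWithin] with δ hδ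
  have hδ' : 0 < δ / 4 := by have : (0 : ℝ) < δ := hδ; linarith
  have hm := lu_mem h.cl hkB hks
  have e1 := lu_mul k hδ'
  have e1' := lu_mul' k hδ'
  have e2 := lu_mul k (δ := 2 * (δ / 4)) (by linarith)
  have e2' := lu_mul' k (δ := 2 * (δ / 4)) (by linarith)
  have e0 : 2 * (2 * (δ / 4)) = δ := by ring
  rw [e0] at e2 e2'
  have e3 : lu k (δ / 4) * lu k δ = lu k δ := by rw [← e2, ← mul_assoc, e1]
  have e3' : lu k δ * lu k (δ / 4) = lu k δ := by rw [← e2', mul_assoc, e1']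
  have hl : ∀ x : A, lu k δ * x * lu k δ ∈ loc (lu k (δ / 4)) (lu_star _ _) := fun x =>
    ⟨by rw [← mul_assoc, ← mul_assoc, e3], by rw [mul_assoc, e3']⟩
  exact h.mid_bimod (hm _) (lu_star _ _) (lu_norm _ _) ⟨e1, e1'⟩ (hm _)
    (hl b) (mul_mem (mul_mem (hm _) hb) (hm _)) (hl c) (mul_mem (mul_mem (hm _) hc) (hm _))
    (by rw [mul_assoc, e2']) (by rw [← mul_assoc, ← mul_assoc, e2])

end TomH

/-- Tomiyama: a norm-one projection `E : A → B` onto a C*-subalgebra is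
`B`-bimodular: `E (b₁ * a * b₂) = b₁ * E a * b₂` for all `a ∈ A`, `b₁ b₂ ∈ B`. -/
theorem tomiyama_bimodular
    {A : Type*} [NonUnitalCStarAlgebra A]
    (B : NonUnitalStarSubalgebra ℂ A) (hBclosed : IsClosed (B : Set A))
    (E : A →ₗ[ℂ] A)
    (hE_mem : ∀ a : A, E a ∈ B)
    (hE_id : ∀ b ∈ B, E b = b)
    (hE_norm : ∀ a : A, ‖E a‖ ≤ ‖a‖) :
    ∀ a : A, ∀ b₁ ∈ B, ∀ b₂ ∈ B, E (b₁ * a * b₂) = b₁ * E a * b₂ := by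
  intro a b₁ hb₁ b₂ hb₂
  exact TomH.bimod ⟨hBclosed, hE_mem, hE_id, hE_norm⟩ a hb₁ hb₂
end
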